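/- arXiv:1409.2843 — 4 statements merged into one kernel-verified Lean document; each statement's English description precedes it below -/
import Mathlib

section
/- For every prime p and every multiset I of elements of (ZMod p)^3 with |I| = 6p - 3, there exists a sub-multiset of I of cardinality 2p whose sum is 0. -/
/-- Functions of a finite set that are polynomials of degree at most `d` in the indicators. -/
def DegLE (p : ℕ) (ι : Type) [DecidableEq ι] (d : ℕ) : Submodule (ZMod p) (Finset ι → ZMod p) :=
  Submodule.span (ZMod p)
    {f | ∃ T : Finset ι, T.card ≤ d ∧ f = fun S => if T ⊆ S then 1 else 0}

section
variable {p : ℕ} {ι : Type} [DecidableEq ι]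

lemma DegLE.mono {d e : ℕ} (h : d ≤ e) : DegLE p ι d ≤ DegLE p ι e := by
  apply Submodule.span_mono
  rintro f ⟨T, hT, rfl⟩
  exact ⟨T, hT.trans h, rfl⟩

lemma DegLE.basic (T : Finset ι) {d : ℕ} (h : T.card ≤ d) :
    (fun S => if T ⊆ S then 1 else 0) ∈ DegLE p ι d :=
  Submodule.subset_span ⟨T, h, rfl⟩

lemma DegLE.mul {d e : ℕ} {f g : Finset ι → ZMod p} (hf : f ∈ DegLE p ι d)
    (hg : g ∈ DegLE p ι e) : f * g ∈ DegLE p ι (d + e) := by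
  have h := Submodule.mul_mem_mul hf hg
  rw [DegLE, DegLE, Submodule.span_mul_span] at h
  refine Submodule.span_mono ?_ h
  rintro _ ⟨_, ⟨T, hT, rfl⟩, _, ⟨U, hU, rfl⟩, rfl⟩
  refine ⟨T ∪ U, (Finset.card_union_le _ _).trans (by omega), ?_⟩
  ext S
  simp only [Pi.mul_apply, Finset.union_subset_iff]
  by_cases h1 : T ⊆ S <;> by_cases h2 : U ⊆ S <;> simp [h1, h2]

lemma DegLE.one {d : ℕ} : (1 : Finset ι → ZMod p) ∈ DegLE p ι d := by
  have := DegLE.basic (p := p) (∅ : Finset ι) (d := d) (by simp)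
  simp only [Finset.empty_subset, if_true] at this
  exact this

lemma DegLE.pow {d : ℕ} {f : Finset ι → ZMod p} (hf : f ∈ DegLE p ι d) (n : ℕ) :
    f ^ n ∈ DegLE p ι (n * d) := by
  induction n with
  | zero => simpa using DegLE.one
  | succ n ih =>
    rw [pow_succ, Nat.succ_mul]
    exact DegLE.mul ih hf

lemma DegLE.lin [Fintype ι] (a : ι → ZMod p) :
    (fun S : Finset ι => ∑ i ∈ S, a i) ∈ DegLE p ι 1 := by
  have h : (fun S : Finset ι => ∑ i ∈ S, a i)
      = ∑ i, a i • (fun S : Finset ι => if {i} ⊆ S then (1 : ZMod p) else 0) := by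
    ext S
    simp [Finset.sum_apply]
  rw [h]
  exact Submodule.sum_mem _ fun i _ => Submodule.smul_mem _ _ (DegLE.basic _ (by simp))

lemma DegLE.choose [Fintype ι] (m : ℕ) :
    (fun S : Finset ι => ((S.card.choose m : ℕ) : ZMod p)) ∈ DegLE p ι m := by
  have h : (fun S : Finset ι => ((S.card.choose m : ℕ) : ZMod p))
      = ∑ T ∈ Finset.powersetCard m (Finset.univ : Finset ι),
        (fun S : Finset ι => if T ⊆ S then (1 : ZMod p) else 0) := by
    ext S
    rw [Finset.sum_apply, Finset.sum_boole, ← Finset.card_powersetCard]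
    congr 2
    ext T
    simp [Finset.mem_powersetCard, and_comm]
  rw [h]
  refine Submodule.sum_mem _ fun T hT => DegLE.basic _ ?_
  exact (Finset.mem_powersetCard.1 hT).2.le

lemma DegLE.annihilate {d : ℕ} {f : Finset ι → ZMod p} (hf : f ∈ DegLE p ι d)
    (J : Finset ι) (hJ : d < J.card) :
    ∑ S ∈ J.powerset, (-1) ^ S.card * f S = 0 := by
  induction hf using Submodule.span_induction with
  | mem f hf =>
    obtain ⟨T, hT, rfl⟩ := hf
    obtain ⟨j, hj, hjT⟩ := Finset.exists_mem_notMem_of_card_lt_card (lt_of_le_of_lt hT hJ)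
    rw [← Finset.insert_erase hj, Finset.sum_powerset_insert (Finset.notMem_erase _ _),
      ← Finset.sum_add_distrib]
    refine Finset.sum_eq_zero fun S hS => ?_
    have hjS : j ∉ S := fun h => Finset.notMem_erase _ _ (Finset.mem_powerset.1 hS h)
    rw [Finset.card_insert_of_notMem hjS]
    have : T ⊆ insert j S ↔ T ⊆ S := by
      rw [Finset.subset_insert_iff, Finset.erase_eq_of_notMem hjT]
    simp only [this]
    ring
  | zero => simp
  | add f g _ _ hf hg => simp [mul_add, Finset.sum_add_distrib, hf, hg]
  | smul c f _ hf =>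
    have : ∀ S : Finset ι, (-1) ^ S.card * (c • f) S = c * ((-1) ^ S.card * f S) := by
      intro S; simp only [Pi.smul_apply, smul_eq_mul]; ring
    simp only [this, ← Finset.mul_sum, hf, mul_zero]

/-- The number of zero-sum subsets of `J` of size `k * p`. -/
def zsCount (a : ι → Fin 3 → ZMod p) (J : Finset ι) (k : ℕ) : ZMod p :=
  (((J.powersetCard (k * p)).filter (fun S => ∑ i ∈ S, a i = 0)).card : ZMod p)

lemma ind_eq [Fact p.Prime] (a : ι → Fin 3 → ZMod p) (S : Finset ι) :
    ((∏ c : Fin 3, (1 - (∑ i ∈ S, a i c) ^ (p - 1))) * (1 - (∑ i ∈ S, (1 : ZMod p)) ^ (p - 1)))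
      = if (∑ i ∈ S, a i = 0) ∧ p ∣ S.card then 1 else 0 := by
  have hp : p - 1 ≠ 0 := by have := (Fact.out : p.Prime).two_le; omega
  have key : ∀ x : ZMod p, 1 - x ^ (p - 1) = if x = 0 then 1 else 0 := by
    intro x
    split_ifs with h
    · simp [h, hp]
    · rw [ZMod.pow_card_sub_one_eq_one h, sub_self]
  have h1 : (∑ i ∈ S, a i = 0) ↔ ∀ c, ∑ i ∈ S, a i c = 0 := by
    rw [funext_iff]; simp [Finset.sum_apply]
  simp only [key, Finset.sum_const, nsmul_eq_mul, mul_one, ZMod.natCast_eq_zero_iff,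
    Finset.prod_ite_zero, h1]
  by_cases h : p ∣ S.card <;> simp [h]

lemma main_count [Fact p.Prime] [Fintype ι] (a : ι → Fin 3 → ZMod p) (J : Finset ι) (m : ℕ)
    (h1 : 4 * (p - 1) + m * p < J.card) (h2 : J.card < 6 * p) :
    ∑ k ∈ Finset.range 6, (-1) ^ k * (k.choose m : ZMod p) * zsCount a J k = 0 := by
  have hp : p.Prime := Fact.out
  have hl : ∀ b : ι → ZMod p,
      (fun S : Finset ι => 1 - (∑ i ∈ S, b i) ^ (p - 1)) ∈ DegLE p ι (p - 1) := by
    intro b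
    have := Submodule.sub_mem _ (DegLE.one (p := p) (ι := ι)) (DegLE.pow (DegLE.lin b) (p - 1))
    rw [mul_one] at this
    exact this
  have hdeg := DegLE.mul (DegLE.mul (DegLE.mul (DegLE.mul (hl (fun i => a i 0)) (hl (fun i => a i 1)))
    (hl (fun i => a i 2))) (hl (fun _ => 1))) (DegLE.choose (m * p))
  have h0 := DegLE.annihilate hdeg J (by omega)
  rw [← h0]
  have hL : ∀ k, (-1) ^ k * (k.choose m : ZMod p) * zsCount a J k
      = ∑ S ∈ J.powerset, if S.card = k * p ∧ ∑ i ∈ S, a i = 0 then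
        (-1) ^ S.card * ((S.card.choose (m * p) : ℕ) : ZMod p) else 0 := by
    intro k
    rw [← Finset.sum_filter, Finset.sum_congr rfl
      (g := fun _ => (-1) ^ k * (k.choose m : ZMod p)), Finset.sum_const, nsmul_eq_mul, mul_comm,
      zsCount]
    · congr 3
      ext S
      simp [Finset.mem_powersetCard, and_assoc]
    · intro S hS
      have hc := (Finset.mem_filter.1 hS).2.1
      rw [hc, mul_comm k p, pow_mul, ZMod.pow_card]
      congr 1
      rw [ZMod.natCast_eq_natCast_iff]
      have := Choose.choose_modEq_choose_mod_mul_choose_div_nat (p := p) (n := p * k) (k := m * p)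
      simpa [hp.pos] using this
  simp only [hL]
  rw [Finset.sum_comm]
  refine Finset.sum_congr rfl fun S hS => ?_
  have hi := ind_eq a S
  rw [Fin.prod_univ_three] at hi
  simp only [Pi.mul_apply]
  rw [hi]
  have hlt : S.card < 6 * p := lt_of_le_of_lt (Finset.card_le_card (Finset.mem_powerset.1 hS)) h2
  by_cases hd : p ∣ S.card
  · obtain ⟨k, hk⟩ := hd
    have hk6 : k < 6 := by
      rw [hk, mul_comm] at hlt
      exact lt_of_mul_lt_mul_right hlt (Nat.zero_le _)
    rw [Finset.sum_eq_single k]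
    · by_cases hz : ∑ i ∈ S, a i = 0 <;> simp [hz, hk, mul_comm]
    · intro b _ hb
      rw [if_neg]
      rintro ⟨h, _⟩
      rw [hk, mul_comm] at h
      exact hb (Nat.eq_of_mul_eq_mul_right hp.pos h).symm
    · intro h; exact absurd (Finset.mem_range.2 hk6) h
  · rw [Finset.sum_eq_zero]
    · simp [hd]
    · intro k _
      rw [if_neg]
      rintro ⟨h, _⟩
      exact hd ⟨k, by rw [h, mul_comm]⟩

lemma zsCount_zero (a : ι → Fin 3 → ZMod p) (J : Finset ι) : zsCount a J 0 = 1 := by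
  simp [zsCount, Finset.filter_singleton]

lemma zsCount_none {a : ι → Fin 3 → ZMod p} {J : Finset ι} {k : ℕ}
    (h : ∀ S ⊆ J, S.card = k * p → ∑ i ∈ S, a i ≠ 0) : zsCount a J k = 0 := by
  rw [zsCount, Finset.filter_eq_empty_iff.2]
  · simp
  · intro S hS
    rw [Finset.mem_powersetCard] at hS
    exact h S hS.1 hS.2

/-- complement in a zero-sum set -/
lemma zs_compl {a : ι → Fin 3 → ZMod p} {T S : Finset ι} (hT : ∑ i ∈ T, a i = 0)
    (hST : S ⊆ T) (hS : ∑ i ∈ S, a i = 0) : ∑ i ∈ T \ S, a i = 0 := by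
  have := Finset.sum_sdiff hST (f := a)
  rw [hT, hS, add_zero] at this
  exact this

/-- Any `4p-3` elements contain a nonempty zero-sum of length `p`, `2p` or `3p`. -/
lemma exists_zs [Fact p.Prime] [Fintype ι] (a : ι → Fin 3 → ZMod p) (J : Finset ι)
    (hJ : J.card = 4 * p - 3)
    (h1 : ∀ S ⊆ J, S.card = p → ∑ i ∈ S, a i ≠ 0)
    (h2 : ∀ S ⊆ J, S.card = 2 * p → ∑ i ∈ S, a i ≠ 0)
    (h3 : ∀ S ⊆ J, S.card = 3 * p → ∑ i ∈ S, a i ≠ 0) : False := by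
  have hp := (Fact.out : p.Prime).two_le
  have h4 : ∀ k, 4 ≤ k → zsCount a J k = 0 := by
    intro k hk
    refine zsCount_none fun S hS hc => ?_
    have := Finset.card_le_card hS
    have : 4 * p ≤ k * p := Nat.mul_le_mul_right _ hk
    omega
  have := main_count a J 0 (by omega) (by omega)
  simp [Finset.sum_range_succ, zsCount_zero, h4, zsCount_none (k := 1) (by simpa using h1),
    zsCount_none h2, zsCount_none h3] at this

lemma no_four [Fact p.Prime] [Fintype ι] (a : ι → Fin 3 → ZMod p) (F : Finset ι)
    (hF : F.card = 4 * p) (hz : ∑ i ∈ F, a i = 0)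
    (h2 : ∀ S ⊆ F, S.card = 2 * p → ∑ i ∈ S, a i ≠ 0)
    (h3 : ∀ S ⊆ F, S.card = 3 * p → ∑ i ∈ S, a i ≠ 0) : False := by
  obtain ⟨J, hJF, hJ⟩ := Finset.exists_subset_card_eq (s := F) (n := 4 * p - 3) (by omega)
  refine exists_zs a J hJ (fun S hS hc h0 => ?_) (fun S hS => h2 S (hS.trans hJF))
    (fun S hS => h3 S (hS.trans hJF))
  refine h3 (F \ S) Finset.sdiff_subset ?_ (zs_compl hz (hS.trans hJF) h0)
  rw [Finset.card_sdiff_of_subset (hS.trans hJF)]; omega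

lemma no_five [Fact p.Prime] [Fintype ι] (a : ι → Fin 3 → ZMod p) (T : Finset ι)
    (hT : T.card = 5 * p) (hz : ∑ i ∈ T, a i = 0)
    (h2 : ∀ S ⊆ T, S.card = 2 * p → ∑ i ∈ S, a i ≠ 0) : False := by
  have h3 : ∀ S ⊆ T, S.card = 3 * p → ∑ i ∈ S, a i ≠ 0 := by
    intro S hS hc h0
    refine h2 (T \ S) Finset.sdiff_subset ?_ (zs_compl hz hS h0)
    rw [Finset.card_sdiff_of_subset hS]; omega
  obtain ⟨J, hJT, hJ⟩ := Finset.exists_subset_card_eq (s := T) (n := 4 * p - 3) (by omega)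
  refine exists_zs a J hJ (fun S hS hc h0 => ?_) (fun S hS => h2 S (hS.trans hJT))
    (fun S hS => h3 S (hS.trans hJT))
  refine no_four a (T \ S) ?_ (zs_compl hz (hS.trans hJT) h0)
    (fun U hU => h2 U (hU.trans Finset.sdiff_subset))
    (fun U hU => h3 U (hU.trans Finset.sdiff_subset))
  rw [Finset.card_sdiff_of_subset (hS.trans hJT)]; omega

/-- Small primes: no `5p-3` elements without zero-sums of length `p` and `2p`. -/
lemma small_case [Fact p.Prime] [Fintype ι] (hp3 : p ≤ 3) (a : ι → Fin 3 → ZMod p) (J : Finset ι)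
    (hJ : 5 * p - 3 ≤ J.card)
    (h1 : ∀ S ⊆ J, S.card = p → ∑ i ∈ S, a i ≠ 0)
    (h2 : ∀ S ⊆ J, S.card = 2 * p → ∑ i ∈ S, a i ≠ 0) : False := by
  have hp := (Fact.out : p.Prime).two_le
  have key : ∀ K ⊆ J, K.card = 4 * p - 3 → p = 3 ∧ ∑ i ∈ K, a i = 0 := by
    intro K hK hc
    by_contra hcon
    refine exists_zs a K hc (fun S hS => h1 S (hS.trans hK)) (fun S hS => h2 S (hS.trans hK)) ?_
    intro S hS hSc h0
    have hle := Finset.card_le_card hS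
    have h3 : p = 3 := by omega
    have : S = K := Finset.eq_of_subset_of_card_le hS (by omega)
    exact hcon ⟨h3, this ▸ h0⟩
  obtain ⟨K, hK, hKc⟩ := Finset.exists_subset_card_eq (s := J) (n := 4 * p - 3) (by omega)
  obtain ⟨rfl, -⟩ := key K hK hKc
  have heq : ∀ i ∈ J, ∀ j ∈ J, i ≠ j → a i = a j := by
    intro i hi j hj hij
    have hc : ((J.erase i).erase j).card = J.card - 2 := by
      rw [Finset.card_erase_of_mem (Finset.mem_erase.2 ⟨hij.symm, hj⟩),
        Finset.card_erase_of_mem hi]; omega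
    obtain ⟨U, hU, hUc⟩ := Finset.exists_subset_card_eq (s := (J.erase i).erase j) (n := 8)
      (by omega)
    have hiU : i ∉ U := fun h => by simpa using hU h
    have hjU : j ∉ U := fun h => by simpa using hU h
    have hUJ : U ⊆ J := hU.trans ((Finset.erase_subset _ _).trans (Finset.erase_subset _ _))
    have e1 := (key (insert i U) (Finset.insert_subset hi hUJ)
      (by rw [Finset.card_insert_of_notMem hiU, hUc])).2
    have e2 := (key (insert j U) (Finset.insert_subset hj hUJ)
      (by rw [Finset.card_insert_of_notMem hjU, hUc])).2
    rw [Finset.sum_insert hiU] at e1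
    rw [Finset.sum_insert hjU, ← e1] at e2
    exact (add_right_cancel e2).symm
  obtain ⟨U, hU, hUc⟩ := Finset.exists_subset_card_eq (s := J) (n := 3) (by omega)
  refine h1 U hU hUc ?_
  obtain ⟨i, hi⟩ : U.Nonempty := Finset.card_pos.1 (by omega)
  rw [Finset.sum_congr rfl (g := fun _ => a i), Finset.sum_const, hUc]
  · ext c
    simp only [Pi.smul_apply, nsmul_eq_mul, Pi.zero_apply]
    rw [show ((3 : ℕ) : ZMod 3) = 0 from rfl, zero_mul]
  · intro j hj
    by_cases hij : j = i
    · rw [hij]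
    · exact heq j (hU hj) i (hU hi) hij

lemma index_version [Fact p.Prime] [Fintype ι] (a : ι → Fin 3 → ZMod p)
    (hc : Fintype.card ι = 6 * p - 3) :
    ∃ S : Finset ι, S.card = 2 * p ∧ ∑ i ∈ S, a i = 0 := by
  by_contra! h2
  have hpp : p.Prime := Fact.out
  have hp := hpp.two_le
  have hcu : (Finset.univ : Finset ι).card = 6 * p - 3 := by rw [Finset.card_univ, hc]
  have h5 : ∀ T : Finset ι, T.card = 5 * p → ∑ i ∈ T, a i ≠ 0 := fun T hT hz =>
    no_five a T hT hz fun S _ => h2 S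
  have cast_ne : ∀ n : ℕ, 0 < n → n < p → (n : ZMod p) ≠ 0 := by
    intro n hn hnp h
    rw [ZMod.natCast_eq_zero_iff] at h
    exact absurd (Nat.le_of_dvd hn h) (by omega)
  by_cases hP : ∃ P : Finset ι, P.card = p ∧ ∑ i ∈ P, a i = 0
  · obtain ⟨P, hPc, hPz⟩ := hP
    set J := (Finset.univ : Finset ι) \ P with hJdef
    have hJ : J.card = 5 * p - 3 := by
      rw [hJdef, Finset.card_sdiff_of_subset (Finset.subset_univ _), hcu]; omega
    have hdis : ∀ S ⊆ J, Disjoint P S := by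
      intro S hS
      exact Finset.disjoint_of_subset_right hS Finset.disjoint_sdiff
    have h1 : ∀ S ⊆ J, S.card = p → ∑ i ∈ S, a i ≠ 0 := by
      intro S hS hSc h0
      refine h2 (P ∪ S) ?_ ?_
      · rw [Finset.card_union_of_disjoint (hdis S hS)]; omega
      · rw [Finset.sum_union (hdis S hS), hPz, h0, add_zero]
    have h4 : ∀ S ⊆ J, S.card = 4 * p → ∑ i ∈ S, a i ≠ 0 := by
      intro S hS hSc h0
      refine h5 (P ∪ S) ?_ ?_
      · rw [Finset.card_union_of_disjoint (hdis S hS)]; omega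
      · rw [Finset.sum_union (hdis S hS), hPz, h0, add_zero]
    by_cases hp3 : p ≤ 3
    · exact small_case hp3 a J hJ.ge h1 (fun S _ => h2 S)
    · have e0 := main_count a J 0 (by omega) (by omega)
      have e1 := main_count a J 1 (by omega) (by omega)
      simp only [Finset.sum_range_succ, Finset.sum_range_zero, zsCount_zero,
        zsCount_none (k := 1) (by simpa using h1), zsCount_none (a := a) (J := J) (fun S _ => h2 S),
        zsCount_none h4, zsCount_none (a := a) (J := J) (fun S _ => h5 S)] at e0 e1
      have c3 := cast_ne 3 (by omega) (by omega)
      norm_num [Nat.choose] at e0 e1 c3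
      rcases e1 with e1 | e1
      · exact c3 e1
      · simp [e1] at e0
  · push Not at hP
    by_cases hp3 : p ≤ 3
    · exact small_case hp3 a Finset.univ (by omega) (fun S _ => hP S) (fun S _ => h2 S)
    · have e0 := main_count a Finset.univ 0 (by omega) (by omega)
      have e1 := main_count a Finset.univ 1 (by omega) (by omega)
      have e2 := main_count a Finset.univ 2 (by omega) (by omega)
      simp only [Finset.sum_range_succ, Finset.sum_range_zero, zsCount_zero,
        zsCount_none (a := a) (J := Finset.univ) (k := 1) (by simpa using hP),
        zsCount_none (a := a) (J := Finset.univ) (fun S _ => h2 S),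
        zsCount_none (a := a) (J := Finset.univ) (fun S _ => h5 S)] at e0 e1 e2
      have c3 := cast_ne 3 (by omega) (by omega)
      have c2 := cast_ne 2 (by omega) (by omega)
      norm_num [Nat.choose] at e0 e1 e2 c3 c2
      generalize zsCount a Finset.univ 3 = A at *
      generalize zsCount a Finset.univ 4 = B at *
      have hB : (2 : ZMod p) * B = 0 := by linear_combination e2 - e1
      have hB0 : B = 0 := (mul_eq_zero.1 hB).resolve_left c2
      have hA : (3 : ZMod p) * A = 0 := by linear_combination -e1 + 4 * hB0
      have hA0 : A = 0 := (mul_eq_zero.1 hA).resolve_left c3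
      simp [hA0, hB0] at e0

end

theorem stmt_0 (p : ℕ) (hp : p.Prime) (I : Multiset (Fin 3 → ZMod p))
    (hI : Multiset.card I = 6 * p - 3) :
    ∃ T ≤ I, Multiset.card T = 2 * p ∧ T.sum = 0 := by
  have : Fact p.Prime := ⟨hp⟩
  obtain ⟨l, rfl⟩ := Quot.exists_rep I
  obtain ⟨S, hS, hz⟩ := index_version (p := p) (ι := Fin l.length) (fun i => l.get i)
    (by simpa using hI)
  refine ⟨S.val.map (fun i => l.get i), ?_, by simpa using hS, hz⟩
  have h : (Finset.univ : Finset (Fin l.length)).val.map (fun i => l.get i) =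
      (l : Multiset (Fin 3 → ZMod p)) := by
    rw [Fin.univ_val_map]; simp
  change _ ≤ (l : Multiset (Fin 3 → ZMod p))
  rw [← h]
  exact Multiset.map_le_map (Finset.val_le_iff.2 (Finset.subset_univ S))
end

section
/- For every prime p and every multiset I of elements of (ZMod p)^3 with |I| = 9p - 3, there exists a sub-multiset of I of cardinality 5p whose sum is 0. -/
section ZeroSum

open Finset

/-- Functions on finite subsets of degree at most `d`. -/
def LowDeg (R ι : Type*) [CommRing R] [DecidableEq ι] (d : ℕ) : Submodule R (Finset ι → R) :=
  Submodule.span R {f | ∃ D : Finset ι, D.card ≤ d ∧ f = fun S => if D ⊆ S then 1 else 0}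

variable {R ι : Type*} [CommRing R] [DecidableEq ι]

lemma lowDeg_basic {d : ℕ} (D : Finset ι) (hD : D.card ≤ d) :
    (fun S => if D ⊆ S then (1 : R) else 0) ∈ LowDeg R ι d :=
  Submodule.subset_span ⟨D, hD, rfl⟩

lemma lowDeg_mul {a b : ℕ} {f g : Finset ι → R} (hf : f ∈ LowDeg R ι a)
    (hg : g ∈ LowDeg R ι b) : f * g ∈ LowDeg R ι (a + b) := by
  have h := Submodule.mul_mem_mul hf hg
  unfold LowDeg at h
  rw [Submodule.span_mul_span] at h
  refine Submodule.span_mono ?_ h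
  rintro _ ⟨_, ⟨D, hD, rfl⟩, _, ⟨E, hE, rfl⟩, rfl⟩
  refine ⟨D ∪ E, (card_union_le D E).trans (by omega), ?_⟩
  funext S
  simp only [Pi.mul_apply, union_subset_iff]
  by_cases h1 : D ⊆ S <;> by_cases h2 : E ⊆ S <;> simp [h1, h2]

lemma lowDeg_one {d : ℕ} : (1 : Finset ι → R) ∈ LowDeg R ι d := by
  have := lowDeg_basic (R := R) (d := d) (∅ : Finset ι) (by simp)
  simp only [empty_subset, if_true] at this
  exact this

lemma lowDeg_pow {a : ℕ} {f : Finset ι → R} (hf : f ∈ LowDeg R ι a) (n : ℕ) :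
    f ^ n ∈ LowDeg R ι (n * a) := by
  induction n with
  | zero => simpa using lowDeg_one
  | succ n ih => rw [pow_succ, add_mul, one_mul]; exact lowDeg_mul ih hf

lemma lowDeg_vanish {d : ℕ} {f : Finset ι → R} (hf : f ∈ LowDeg R ι d) (J : Finset ι)
    (hJ : d < J.card) : ∑ S ∈ J.powerset, (-1 : R) ^ S.card * f S = 0 := by
  unfold LowDeg at hf
  induction hf using Submodule.span_induction with
  | mem f hf =>
    obtain ⟨D, hD, rfl⟩ := hf
    obtain ⟨x, hxJ, hxD⟩ : ∃ x ∈ J, x ∉ D := by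
      by_contra! h
      have := card_le_card (show J ⊆ D from h)
      omega
    obtain ⟨K, hxK, rfl⟩ : ∃ K, x ∉ K ∧ J = insert x K :=
      ⟨J.erase x, by simp, (insert_erase hxJ).symm⟩
    rw [sum_powerset_insert hxK, ← sum_add_distrib]
    refine sum_eq_zero fun S hS => ?_
    have hxS : x ∉ S := fun h => hxK (mem_powerset.1 hS h)
    rw [card_insert_of_notMem hxS]
    have : D ⊆ insert x S ↔ D ⊆ S := by
      rw [subset_insert_iff_of_notMem hxD]
    simp only [this]
    ring
  | zero => simp
  | add f g _ _ h1 h2 => simp [mul_add, sum_add_distrib, h1, h2]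
  | smul c f _ h =>
    have : ∀ S : Finset ι, (-1 : R) ^ S.card * (c • f) S = c * ((-1 : R) ^ S.card * f S) := by
      intro S; simp; ring
    simp_rw [this]
    rw [← mul_sum, h, mul_zero]

variable [Fintype ι]

set_option linter.unusedSectionVars false

lemma lowDeg_sum (c : ι → R) : (fun S : Finset ι => ∑ i ∈ S, c i) ∈ LowDeg R ι 1 := by
  have : (fun S : Finset ι => ∑ i ∈ S, c i)
      = ∑ i, c i • (fun S : Finset ι => if {i} ⊆ S then (1 : R) else 0) := by
    funext S
    simp [Finset.sum_apply]
  rw [this]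
  exact Submodule.sum_mem _ fun i _ => Submodule.smul_mem _ _ (lowDeg_basic _ (by simp))

lemma lowDeg_choose (e : ℕ) :
    (fun S : Finset ι => (S.card.choose e : R)) ∈ LowDeg R ι e := by
  have : (fun S : Finset ι => (S.card.choose e : R))
      = ∑ D ∈ powersetCard e univ, (fun S : Finset ι => if D ⊆ S then (1 : R) else 0) := by
    funext S
    rw [Finset.sum_apply, ← sum_filter, sum_const, ← card_powersetCard]
    simp only [nsmul_eq_mul, mul_one]
    congr 2
    ext D
    simp [mem_powersetCard, and_comm]
  rw [this]
  exact Submodule.sum_mem _ fun D hD => lowDeg_basic _ (mem_powersetCard.1 hD).2.le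

variable {p : ℕ}

/-- The number of zero-sum subsets of `J` with `k * p` elements. -/
def ZN (v : ι → Fin 3 → ZMod p) (J : Finset ι) (k : ℕ) : ℕ :=
  #{S ∈ J.powerset | S.card = k * p ∧ ∑ i ∈ S, v i = 0}

/-- `J` has a zero-sum subset with `k * p` elements. -/
def ZH (v : ι → Fin 3 → ZMod p) (J : Finset ι) (k : ℕ) : Prop :=
  ∃ S ⊆ J, S.card = k * p ∧ ∑ i ∈ S, v i = 0

lemma zn_eq_zero {v : ι → Fin 3 → ZMod p} {J : Finset ι} {k : ℕ} (h : ¬ ZH v J k) :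
    ZN v J k = 0 := by
  unfold ZN
  rw [card_eq_zero, filter_eq_empty_iff]
  intro S hS h'
  exact h ⟨S, mem_powerset.1 hS, h'⟩

lemma zn_zero [Fact p.Prime] (v : ι → Fin 3 → ZMod p) (J : Finset ι) : ZN v J 0 = 1 := by
  unfold ZN
  rw [card_eq_one]
  refine ⟨∅, ?_⟩
  ext S
  simp only [mem_filter, mem_powerset, zero_mul, card_eq_zero, mem_singleton]
  constructor
  · exact fun h => h.2.1
  · rintro rfl; simp

lemma indic [Fact p.Prime] (x : ZMod p) : 1 - x ^ (p - 1) = if x = 0 then 1 else 0 := by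
  have := (Fact.out : p.Prime).two_le
  split_ifs with h
  · subst h; rw [zero_pow (by omega)]; simp
  · rw [ZMod.pow_card_sub_one_eq_one h]; simp

lemma neg_one_pow_mul_p [Fact p.Prime] (k : ℕ) : (-1 : ZMod p) ^ (k * p) = (-1) ^ k := by
  rw [pow_mul, ZMod.pow_card]

theorem cw [Fact p.Prime] (v : ι → Fin 3 → ZMod p) (J : Finset ι) (i : ℕ)
    (hi : 4 * p - 3 + i * p ≤ J.card) (hJ : J.card < 9 * p) :
    ∑ k ∈ range 9, (-1 : ZMod p) ^ k * (k.choose i : ZMod p) * (ZN v J k : ZMod p) = 0 := by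
  have hp := (Fact.out : p.Prime)
  have h2 := hp.two_le
  have hd (c : ι → ZMod p) : (fun S : Finset ι => 1 - (∑ i ∈ S, c i) ^ (p - 1))
      ∈ LowDeg (ZMod p) ι (p - 1) := by
    have := lowDeg_pow (lowDeg_sum c) (p - 1)
    rw [mul_one] at this
    exact Submodule.sub_mem _ lowDeg_one this
  have hV := lowDeg_vanish (lowDeg_mul (lowDeg_mul (lowDeg_mul (lowDeg_mul
    (hd fun i => v i 0) (hd fun i => v i 1)) (hd fun i => v i 2)) (hd fun _ => 1))
    (lowDeg_choose (i * p))) J (by omega)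
  rw [← hV]
  simp only [Pi.mul_apply, indic]
  have hterm : ∀ S ∈ J.powerset, (-1 : ZMod p) ^ S.card * ((((if ∑ i ∈ S, v i 0 = 0 then 1 else 0) *
      (if ∑ i ∈ S, v i 1 = 0 then 1 else 0)) * (if ∑ i ∈ S, v i 2 = 0 then 1 else 0)) *
      (if ∑ i ∈ S, (1 : ZMod p) = 0 then 1 else 0) * (S.card.choose (i * p) : ZMod p))
      = ∑ k ∈ range 9, (-1 : ZMod p) ^ k * (k.choose i : ZMod p) *
        (if S.card = k * p ∧ ∑ i ∈ S, v i = 0 then 1 else 0) := by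
    intro S hS
    have hz : ∑ i ∈ S, v i = 0 ↔ (∑ i ∈ S, v i 0 = 0 ∧ ∑ i ∈ S, v i 1 = 0) ∧
        ∑ i ∈ S, v i 2 = 0 := by
      rw [funext_iff]
      simp [Fin.forall_fin_succ, Finset.sum_apply, and_assoc]
    simp only [hz]
    have hc : ∑ i ∈ S, (1 : ZMod p) = 0 ↔ p ∣ S.card := by
      simp [ZMod.natCast_eq_zero_iff]
    simp only [hc]
    by_cases hdv : p ∣ S.card
    · obtain ⟨m, hm⟩ := hdv
      have hm9 : m < 9 := by
        have := card_le_card (mem_powerset.1 hS)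
        by_contra! h
        have : p * 9 ≤ p * m := Nat.mul_le_mul_left _ h
        omega
      have hk : ∀ k, S.card = k * p ↔ k = m := by
        intro k
        rw [hm, mul_comm]
        constructor
        · intro h; exact (Nat.eq_of_mul_eq_mul_right (by omega) h).symm
        · rintro rfl; rfl
      have hch : ((p * m).choose (i * p) : ZMod p) = (m.choose i : ZMod p) := by
        have := Choose.choose_modEq_choose_mod_mul_choose_div_nat (n := p * m) (k := i * p) (p := p)
        rw [Nat.mul_mod_right, Nat.mul_mod_left, Nat.mul_div_cancel_left _ (by omega),
          Nat.mul_div_cancel _ (by omega)] at this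
        have := (ZMod.natCast_eq_natCast_iff _ _ _).2 this
        simpa using this
      simp only [hk]
      rw [sum_eq_single m]
      · rw [hm, hch, mul_comm p m, neg_one_pow_mul_p]
        by_cases h0 : ∑ i ∈ S, v i 0 = 0 <;> by_cases h1 : ∑ i ∈ S, v i 1 = 0 <;>
          by_cases h2 : ∑ i ∈ S, v i 2 = 0 <;> simp [h0, h1, h2]
      · intro b _ hb; simp [hb]
      · intro h; simp at h; omega
    · have : ∀ k, S.card ≠ k * p := fun k hk => hdv ⟨k, by rw [hk, mul_comm]⟩
      simp [hdv, this]
  rw [sum_congr rfl hterm, sum_comm]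
  refine sum_congr rfl fun k _ => ?_
  rw [← mul_sum]
  congr 1
  unfold ZN
  rw [card_filter]
  push_cast
  rfl

lemma cw0 [Fact p.Prime] (v : ι → Fin 3 → ZMod p) (J : Finset ι)
    (hi : 4 * p - 3 ≤ J.card) (hJ : J.card < 9 * p) :
    1 - (ZN v J 1 : ZMod p) + ZN v J 2 - ZN v J 3 + ZN v J 4 - ZN v J 5 + ZN v J 6
      - ZN v J 7 + ZN v J 8 = 0 := by
  have h := cw v J 0 (by omega) hJ
  simp [sum_range_succ, zn_zero] at h
  linear_combination h

lemma cw1 [Fact p.Prime] (v : ι → Fin 3 → ZMod p) (J : Finset ι)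
    (hi : 5 * p - 3 ≤ J.card) (hJ : J.card < 9 * p) :
    - (ZN v J 1 : ZMod p) + 2 * ZN v J 2 - 3 * ZN v J 3 + 4 * ZN v J 4 - 5 * ZN v J 5
      + 6 * ZN v J 6 - 7 * ZN v J 7 + 8 * ZN v J 8 = 0 := by
  have h := cw v J 1 (by have := (Fact.out : p.Prime).two_le; omega) hJ
  simp [sum_range_succ] at h
  linear_combination h

lemma cw2 [Fact p.Prime] (v : ι → Fin 3 → ZMod p) (J : Finset ι)
    (hi : 6 * p - 3 ≤ J.card) (hJ : J.card < 9 * p) :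
    (ZN v J 2 : ZMod p) - 3 * ZN v J 3 + 6 * ZN v J 4 - 10 * ZN v J 5
      + 15 * ZN v J 6 - 21 * ZN v J 7 + 28 * ZN v J 8 = 0 := by
  have h := cw v J 2 (by have := (Fact.out : p.Prime).two_le; omega) hJ
  simp [sum_range_succ, Nat.choose] at h
  linear_combination h

lemma cw3 [Fact p.Prime] (v : ι → Fin 3 → ZMod p) (J : Finset ι)
    (hi : 7 * p - 3 ≤ J.card) (hJ : J.card < 9 * p) :
    - (ZN v J 3 : ZMod p) + 4 * ZN v J 4 - 10 * ZN v J 5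
      + 20 * ZN v J 6 - 35 * ZN v J 7 + 56 * ZN v J 8 = 0 := by
  have h := cw v J 3 (by have := (Fact.out : p.Prime).two_le; omega) hJ
  simp [sum_range_succ, Nat.choose] at h
  linear_combination h

lemma cw4 [Fact p.Prime] (v : ι → Fin 3 → ZMod p) (J : Finset ι)
    (hi : 8 * p - 3 ≤ J.card) (hJ : J.card < 9 * p) :
    (ZN v J 4 : ZMod p) - 5 * ZN v J 5
      + 15 * ZN v J 6 - 35 * ZN v J 7 + 70 * ZN v J 8 = 0 := by
  have h := cw v J 4 (by have := (Fact.out : p.Prime).two_le; omega) hJ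
  simp [sum_range_succ, Nat.choose] at h
  linear_combination h

lemma zc {v : ι → Fin 3 → ZMod p} {J : Finset ι} {k : ℕ} (h : ¬ ZH v J k) :
    (ZN v J k : ZMod p) = 0 := by
  rw [zn_eq_zero h, Nat.cast_zero]

lemma ZH.mono {v : ι → Fin 3 → ZMod p} {J K : Finset ι} {k : ℕ} (h : ZH v J k) (hJK : J ⊆ K) :
    ZH v K k := by
  obtain ⟨S, hS, h⟩ := h
  exact ⟨S, hS.trans hJK, h⟩

lemma ZH.card {v : ι → Fin 3 → ZMod p} {J : Finset ι} {k : ℕ} (h : ZH v J k) :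
    k * p ≤ J.card := by
  obtain ⟨S, hS, h, _⟩ := h
  exact h ▸ card_le_card hS

lemma ZH.add {v : ι → Fin 3 → ZMod p} {J S : Finset ι} {k : ℕ} (h : ZH v (J \ S) k) (j : ℕ)
    (hSJ : S ⊆ J) (hS : S.card = j * p) (hs : ∑ i ∈ S, v i = 0) : ZH v J (j + k) := by
  obtain ⟨X, hX, hXc, hXs⟩ := h
  have hd : Disjoint S X := (disjoint_sdiff).mono_right hX
  refine ⟨S ∪ X, union_subset hSJ (hX.trans sdiff_subset), ?_, ?_⟩
  · rw [card_union_of_disjoint hd, hS, hXc, add_mul]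
  · rw [sum_union hd, hs, hXs, add_zero]

lemma compl_zero {v : ι → Fin 3 → ZMod p} {T S : Finset ι} (hST : S ⊆ T)
    (hT : ∑ i ∈ T, v i = 0) (hs : ∑ i ∈ S, v i = 0) : ∑ i ∈ T \ S, v i = 0 := by
  have := sum_sdiff (f := v) hST
  rw [hs, hT, add_zero] at this
  exact this

lemma ZH.compl {v : ι → Fin 3 → ZMod p} {T : Finset ι} {k : ℕ} (h : ZH v T k) (m j : ℕ)
    (hm : k + j = m) (hTc : T.card = m * p) (hT : ∑ i ∈ T, v i = 0) : ZH v T j := by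
  obtain ⟨S, hS, hSc, hs⟩ := h
  refine ⟨T \ S, sdiff_subset, ?_, compl_zero hS hT hs⟩
  rw [card_sdiff_of_subset hS, hTc, hSc, ← hm, add_mul]
  omega

lemma two_nz [Fact p.Prime] (h : 3 ≤ p) : (2 : ZMod p) ≠ 0 := by
  intro h0
  have : ((2 : ℕ) : ZMod p) = 0 := by exact_mod_cast h0
  rw [ZMod.natCast_eq_zero_iff] at this
  have := Nat.le_of_dvd (by norm_num) this
  omega

lemma three_nz [Fact p.Prime] (h : 5 ≤ p) : (3 : ZMod p) ≠ 0 := by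
  intro h0
  have : ((3 : ℕ) : ZMod p) = 0 := by exact_mod_cast h0
  rw [ZMod.natCast_eq_zero_iff] at this
  have := Nat.le_of_dvd (by norm_num) this
  omega

lemma exists_erase {T : Finset ι} (h : 0 < T.card) :
    ∃ U ⊆ T, U.card = T.card - 1 := by
  obtain ⟨x, hx⟩ := card_pos.1 h
  exact ⟨T.erase x, erase_subset _ _, card_erase_of_mem hx⟩

lemma step6 [Fact p.Prime] (h3 : 3 ≤ p) {v : ι → Fin 3 → ZMod p}
    (hF : ∀ J, ¬ ZH v J 5) (T : Finset ι) (hTc : T.card = 6 * p) (hT : ∑ i ∈ T, v i = 0) :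
    ZH v T 3 := by
  by_contra n3
  have n1 : ¬ ZH v T 1 := fun h => hF T (h.compl 6 5 rfl hTc hT)
  obtain ⟨U, hUT, hUc⟩ := exists_erase (T := T) (by omega)
  have m1 := zc fun h : ZH v U 1 => n1 (h.mono hUT)
  have m3 := zc fun h : ZH v U 3 => n3 (h.mono hUT)
  have m5 := zc (hF U)
  have m6 := zc fun h : ZH v U 6 => by have := h.card; omega
  have m7 := zc fun h : ZH v U 7 => by have := h.card; omega
  have m8 := zc fun h : ZH v U 8 => by have := h.card; omega
  have e0 := cw0 v U (by omega) (by omega)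
  have e1 := cw1 v U (by omega) (by omega)
  have e2 := cw2 v U (by omega) (by omega)
  simp only [m1, m3, m5, m6, m7, m8] at e0 e1 e2
  have : (2 : ZMod p) ^ 3 = 0 := by linear_combination 8 * e0 - 5 * e1 + 2 * e2
  exact two_nz h3 (eq_zero_of_pow_eq_zero this)

lemma step8 [Fact p.Prime] (h3 : 3 ≤ p) {v : ι → Fin 3 → ZMod p}
    (hF : ∀ J, ¬ ZH v J 5) (T : Finset ι) : ¬ ZH v T 8 := by
  rintro ⟨T, -, hTc, hT⟩
  have n3 : ¬ ZH v T 3 := fun h => hF T (h.compl 8 5 rfl hTc hT)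
  have n6 : ¬ ZH v T 6 := by
    rintro ⟨S, hST, hSc, hS⟩
    exact n3 ((step6 h3 hF S hSc hS).mono hST)
  have n2 : ¬ ZH v T 2 := fun h => n6 (h.compl 8 6 rfl hTc hT)
  have n7 : ¬ ZH v T 7 := by
    rintro ⟨Z, hZT, hZc, hZ⟩
    obtain ⟨U, hUZ, hUc⟩ := exists_erase (T := Z) (by omega)
    have m1 := zc fun h : ZH v U 1 => n6 (((h.mono hUZ).compl 7 6 rfl hZc hZ).mono hZT)
    have m2 := zc fun h : ZH v U 2 => n2 (h.mono (hUZ.trans hZT))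
    have m3 := zc fun h : ZH v U 3 => n3 (h.mono (hUZ.trans hZT))
    have m4 := zc fun h : ZH v U 4 => n3 (((h.mono hUZ).compl 7 3 rfl hZc hZ).mono hZT)
    have m5 := zc (hF U)
    have m6 := zc fun h : ZH v U 6 => n6 (h.mono (hUZ.trans hZT))
    have m7 := zc fun h : ZH v U 7 => by have := h.card; omega
    have m8 := zc fun h : ZH v U 8 => by have := h.card; omega
    have e0 := cw0 v U (by omega) (by omega)
    simp [m1, m2, m3, m4, m5, m6, m7, m8] at e0
  have n1 : ¬ ZH v T 1 := fun h => n7 (h.compl 8 7 rfl hTc hT)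
  obtain ⟨U, hUT, hUc⟩ := exists_erase (T := T) (by omega)
  have m1 := zc fun h : ZH v U 1 => n1 (h.mono hUT)
  have m2 := zc fun h : ZH v U 2 => n2 (h.mono hUT)
  have m3 := zc fun h : ZH v U 3 => n3 (h.mono hUT)
  have m5 := zc (hF U)
  have m6 := zc fun h : ZH v U 6 => n6 (h.mono hUT)
  have m7 := zc fun h : ZH v U 7 => n7 (h.mono hUT)
  have m8 := zc fun h : ZH v U 8 => by have := h.card; omega
  have e0 := cw0 v U (by omega) (by omega)
  have e1 := cw1 v U (by omega) (by omega)
  simp only [m1, m2, m3, m5, m6, m7, m8] at e0 e1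
  have : (2 : ZMod p) ^ 2 = 0 := by linear_combination 4 * e0 - e1
  exact two_nz h3 (eq_zero_of_pow_eq_zero this)

lemma step7 [Fact p.Prime] (h5 : 5 ≤ p) {v : ι → Fin 3 → ZMod p}
    (hF : ∀ J, ¬ ZH v J 5) (J : Finset ι) : ¬ ZH v J 7 := by
  rintro ⟨Z, -, hZc, hZ⟩
  have n2 : ¬ ZH v Z 2 := fun h => hF Z (h.compl 7 5 rfl hZc hZ)
  have n6 : ¬ ZH v Z 6 := by
    rintro ⟨T, hTZ, hTc, hT⟩
    obtain ⟨U, hUT, hUc⟩ := exists_erase (T := T) (by omega)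
    have m1 := zc fun h : ZH v U 1 => hF T ((h.mono hUT).compl 6 5 rfl hTc hT)
    have m2 := zc fun h : ZH v U 2 => n2 (h.mono (hUT.trans hTZ))
    have m4 := zc fun h : ZH v U 4 => n2 (((h.mono hUT).compl 6 2 rfl hTc hT).mono hTZ)
    have m5 := zc (hF U)
    have m6 := zc fun h : ZH v U 6 => by have := h.card; omega
    have m7 := zc fun h : ZH v U 7 => by have := h.card; omega
    have m8 := zc fun h : ZH v U 8 => by have := h.card; omega
    have e0 := cw0 v U (by omega) (by omega)
    have e1 := cw1 v U (by omega) (by omega)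
    simp only [m1, m2, m4, m5, m6, m7, m8] at e0 e1
    exact three_nz h5 (by linear_combination 3 * e0 - e1)
  obtain ⟨U, hUZ, hUc⟩ := exists_erase (T := Z) (by omega)
  have m1 := zc fun h : ZH v U 1 => n6 ((h.mono hUZ).compl 7 6 rfl hZc hZ)
  have m2 := zc fun h : ZH v U 2 => n2 (h.mono hUZ)
  have m5 := zc (hF U)
  have m6 := zc fun h : ZH v U 6 => n6 (h.mono hUZ)
  have m7 := zc fun h : ZH v U 7 => by have := h.card; omega
  have m8 := zc fun h : ZH v U 8 => by have := h.card; omega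
  have e0 := cw0 v U (by omega) (by omega)
  have e1 := cw1 v U (by omega) (by omega)
  have e2 := cw2 v U (by omega) (by omega)
  simp only [m1, m2, m5, m6, m7, m8] at e0 e1 e2
  have : (2 : ZMod p) ^ 2 * 3 = 0 := by linear_combination 12 * e0 - 6 * e1 + 2 * e2
  exact mul_ne_zero (pow_ne_zero 2 (two_nz (by omega))) (three_nz h5) this

lemma step10 [Fact (Nat.Prime 3)] (v : ι → Fin 3 → ZMod 3) (J : Finset ι) (hJ : 10 ≤ J.card)
    (n2 : ¬ ZH v J 2) : ZH v J 1 := by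
  by_contra n1
  obtain ⟨K, hKJ, hKc⟩ := exists_subset_card_eq hJ
  have hall : ∀ x ∈ K, v x = ∑ i ∈ K, v i := by
    intro x hx
    have hUc : (K.erase x).card = 9 := by rw [card_erase_of_mem hx, hKc]
    have hUJ : K.erase x ⊆ J := (erase_subset _ _).trans hKJ
    have h3 : ZH v (K.erase x) 3 := by
      by_contra n3
      have m1 := zc fun h : ZH v (K.erase x) 1 => n1 (h.mono hUJ)
      have m2 := zc fun h : ZH v (K.erase x) 2 => n2 (h.mono hUJ)
      have m3 := zc n3
      have m4 := zc fun h : ZH v (K.erase x) 4 => by have := h.card; omega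
      have m5 := zc fun h : ZH v (K.erase x) 5 => by have := h.card; omega
      have m6 := zc fun h : ZH v (K.erase x) 6 => by have := h.card; omega
      have m7 := zc fun h : ZH v (K.erase x) 7 => by have := h.card; omega
      have m8 := zc fun h : ZH v (K.erase x) 8 => by have := h.card; omega
      have e0 := cw0 v (K.erase x) (by omega) (by omega)
      simp [m1, m2, m3, m4, m5, m6, m7, m8] at e0
    obtain ⟨S, hS, hSc, hs⟩ := h3
    have := eq_of_subset_of_card_le hS (by omega)
    rw [this] at hs
    rw [← add_sum_erase K v hx, hs, add_zero]
  obtain ⟨S, hSK, hSc⟩ := exists_subset_card_eq (s := K) (n := 3) (by omega)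
  refine n1 ⟨S, hSK.trans hKJ, by omega, ?_⟩
  rw [sum_congr rfl fun x hx => hall x (hSK hx), sum_const, hSc]
  funext j
  simp only [Pi.smul_apply, Pi.zero_apply, nsmul_eq_mul]
  rw [CharP.cast_eq_zero, zero_mul]

lemma step7_three [Fact (Nat.Prime 3)] {v : ι → Fin 3 → ZMod 3}
    (hF : ∀ J, ¬ ZH v J 5) (J : Finset ι) : ¬ ZH v J 7 := by
  rintro ⟨Z, -, hZc, hZ⟩
  have n2 : ¬ ZH v Z 2 := fun h => hF Z (h.compl 7 5 rfl hZc hZ)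
  obtain ⟨X, hXZ, hXc, hX⟩ := step10 v Z (by omega) n2
  have hc : (Z \ X).card = 18 := by rw [card_sdiff_of_subset hXZ]; omega
  have := step10 v (Z \ X) (by omega) fun h => n2 (h.mono sdiff_subset)
  exact n2 (this.add 1 hXZ hXc hX)

lemma step7_two [Fact (Nat.Prime 2)] {v : ι → Fin 3 → ZMod 2}
    (hF : ∀ J, ¬ ZH v J 5) (J : Finset ι) : ¬ ZH v J 7 := by
  rintro ⟨Z, -, hZc, hZ⟩
  have n2 : ¬ ZH v Z 2 := fun h => hF Z (h.compl 7 5 rfl hZc hZ)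
  obtain ⟨U, hUZ, hUc⟩ := exists_erase (T := Z) (by omega)
  have m2 := zc fun h : ZH v U 2 => n2 (h.mono hUZ)
  have m5 := zc (hF U)
  have m7 := zc fun h : ZH v U 7 => by have := h.card; omega
  have m8 := zc fun h : ZH v U 8 => by have := h.card; omega
  have e0 := cw0 v U (by omega) (by omega)
  have e1 := cw1 v U (by omega) (by omega)
  have e4 := cw4 v U (by omega) (by omega)
  simp only [m2, m5, m7, m8] at e0 e1 e4
  have h2 : (2 : ZMod 2) = 0 := rfl
  have : (1 : ZMod 2) = 0 := by
    linear_combination e0 + e1 + e4 +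
      (ZN v U 1 + 2 * ZN v U 3 - 3 * ZN v U 4 - 11 * ZN v U 6) * h2
  exact one_ne_zero this

lemma step1 [Fact p.Prime] {v : ι → Fin 3 → ZMod p} (hcard : Fintype.card ι = 9 * p - 3)
    (hF : ∀ J, ¬ ZH v J 5) (h7 : ∀ J, ¬ ZH v J 7) : ¬ ZH v univ 1 := by
  have h2 := (Fact.out : p.Prime).two_le
  rintro ⟨X, hXu, hXc, hX⟩
  have hc : (univ \ X).card = 8 * p - 3 := by
    rw [card_sdiff_of_subset hXu, card_univ, hcard]; omega
  have m4 := zc fun h : ZH v (univ \ X) 4 => hF _ (h.add 1 hXu hXc hX)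
  have m5 := zc (hF (univ \ X))
  have m6 := zc fun h : ZH v (univ \ X) 6 => h7 _ (h.add 1 hXu hXc hX)
  have m7 := zc (h7 (univ \ X))
  have m8 := zc fun h : ZH v (univ \ X) 8 => by have := h.card; omega
  have e0 := cw0 v (univ \ X) (by omega) (by omega)
  have e1 := cw1 v (univ \ X) (by omega) (by omega)
  have e2 := cw2 v (univ \ X) (by omega) (by omega)
  have e3 := cw3 v (univ \ X) (by omega) (by omega)
  simp only [m4, m5, m6, m7, m8] at e0 e1 e2 e3
  have : (1 : ZMod p) = 0 := by linear_combination e0 - e1 + e2 - e3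
  exact one_ne_zero this

lemma step2 [Fact p.Prime] (h3 : 3 ≤ p) {v : ι → Fin 3 → ZMod p}
    (hcard : Fintype.card ι = 9 * p - 3)
    (hF : ∀ J, ¬ ZH v J 5) (n1 : ¬ ZH v univ 1) : ¬ ZH v univ 2 := by
  rintro ⟨X, hXu, hXc, hX⟩
  have hc : (univ \ X).card = 7 * p - 3 := by
    rw [card_sdiff_of_subset hXu, card_univ, hcard]; omega
  have m1 := zc fun h : ZH v (univ \ X) 1 => n1 (h.mono sdiff_subset)
  have m3 := zc fun h : ZH v (univ \ X) 3 => hF _ (h.add 2 hXu hXc hX)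
  have m5 := zc (hF (univ \ X))
  have m6 := zc fun h : ZH v (univ \ X) 6 => step8 h3 hF _ (h.add 2 hXu hXc hX)
  have m7 := zc fun h : ZH v (univ \ X) 7 => by have := h.card; omega
  have m8 := zc fun h : ZH v (univ \ X) 8 => by have := h.card; omega
  have e0 := cw0 v (univ \ X) (by omega) (by omega)
  have e1 := cw1 v (univ \ X) (by omega) (by omega)
  have e2 := cw2 v (univ \ X) (by omega) (by omega)
  simp only [m1, m3, m5, m6, m7, m8] at e0 e1 e2
  have : (2 : ZMod p) ^ 3 = 0 := by linear_combination 8 * e0 - 5 * e1 + 2 * e2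
  exact two_nz h3 (eq_zero_of_pow_eq_zero this)

lemma final_large [Fact p.Prime] (h5 : 5 ≤ p) {v : ι → Fin 3 → ZMod p}
    (hcard : Fintype.card ι = 9 * p - 3) (hF : ∀ J, ¬ ZH v J 5) : False := by
  have h3 : 3 ≤ p := by omega
  have n8 := step8 h3 hF
  have n7 := step7 h5 hF
  have n1 := step1 hcard hF n7
  have n2 := step2 h3 hcard hF n1
  have n3 : ¬ ZH v univ 3 := by
    rintro ⟨X, hXu, hXc, hX⟩
    have hc : (univ \ X).card = 6 * p - 3 := by
      rw [card_sdiff_of_subset hXu, card_univ, hcard]; omega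
    have m1 := zc fun h : ZH v (univ \ X) 1 => n1 (h.mono sdiff_subset)
    have m2 := zc fun h : ZH v (univ \ X) 2 => n2 (h.mono sdiff_subset)
    have m4 := zc fun h : ZH v (univ \ X) 4 => n7 _ (h.add 3 hXu hXc hX)
    have m5 := zc (hF (univ \ X))
    have m6 := zc fun h : ZH v (univ \ X) 6 => by have := h.card; omega
    have m7 := zc (n7 (univ \ X))
    have m8 := zc (n8 (univ \ X))
    have e0 := cw0 v (univ \ X) (by omega) (by omega)
    have e1 := cw1 v (univ \ X) (by omega) (by omega)
    simp only [m1, m2, m4, m5, m6, m7, m8] at e0 e1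
    exact three_nz h5 (by linear_combination 3 * e0 - e1)
  have n4 : ¬ ZH v univ 4 := by
    rintro ⟨X, hXu, hXc, hX⟩
    have hc : (univ \ X).card = 5 * p - 3 := by
      rw [card_sdiff_of_subset hXu, card_univ, hcard]; omega
    have m1 := zc fun h : ZH v (univ \ X) 1 => n1 (h.mono sdiff_subset)
    have m2 := zc fun h : ZH v (univ \ X) 2 => n2 (h.mono sdiff_subset)
    have m3 := zc fun h : ZH v (univ \ X) 3 => n3 (h.mono sdiff_subset)
    have m4 := zc fun h : ZH v (univ \ X) 4 => n8 _ (h.add 4 hXu hXc hX)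
    have m5 := zc (hF (univ \ X))
    have m6 := zc fun h : ZH v (univ \ X) 6 => by have := h.card; omega
    have m7 := zc (n7 (univ \ X))
    have m8 := zc (n8 (univ \ X))
    have e0 := cw0 v (univ \ X) (by omega) (by omega)
    simp [m1, m2, m3, m4, m5, m6, m7, m8] at e0
  have hc : (univ : Finset ι).card = 9 * p - 3 := by rw [card_univ, hcard]
  have e0 := cw0 v univ (by omega) (by omega)
  have e1 := cw1 v univ (by omega) (by omega)
  simp only [zc n1, zc n2, zc n3, zc n4, zc (hF univ), zc (n7 univ), zc (n8 univ)] at e0 e1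
  have : (2 : ZMod p) * 3 = 0 := by linear_combination 6 * e0 - e1
  exact mul_ne_zero (two_nz h3) (three_nz h5) this

lemma final_three [Fact (Nat.Prime 3)] {v : ι → Fin 3 → ZMod 3}
    (hcard : Fintype.card ι = 9 * 3 - 3) (hF : ∀ J, ¬ ZH v J 5) : False := by
  have n1 := step1 hcard hF (step7_three hF)
  have n2 := step2 le_rfl hcard hF n1
  exact n1 (step10 v univ (by rw [card_univ, hcard]; norm_num) n2)

lemma final_two [Fact (Nat.Prime 2)] {v : ι → Fin 3 → ZMod 2}
    (hcard : Fintype.card ι = 9 * 2 - 3) (hF : ∀ J, ¬ ZH v J 5) : False := by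
  have n1 := step1 hcard hF (step7_two hF)
  obtain ⟨x, y, hxy, h⟩ := Fintype.exists_ne_map_eq_of_card_lt v (by
    rw [hcard, Fintype.card_fun, ZMod.card]; simp)
  refine n1 ⟨{x, y}, subset_univ _, by rw [card_pair hxy], ?_⟩
  rw [sum_pair hxy, h]
  funext j
  exact CharTwo.add_self_eq_zero (v y j)

lemma exists_five [Fact p.Prime] (v : ι → Fin 3 → ZMod p)
    (hcard : Fintype.card ι = 9 * p - 3) : ZH v univ 5 := by
  by_contra hn
  have hF : ∀ J, ¬ ZH v J 5 := fun J h => hn (h.mono (subset_univ J))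
  have hp := (Fact.out : p.Prime)
  have h2 := hp.two_le
  by_cases h5 : 5 ≤ p
  · exact final_large h5 hcard hF
  · have : p ≠ 4 := by rintro rfl; exact absurd hp (by norm_num)
    obtain rfl | rfl : p = 2 ∨ p = 3 := by omega
    · exact final_two hcard hF
    · exact final_three hcard hF

end ZeroSum

theorem stmt_3 (p : ℕ) (hp : p.Prime) (I : Multiset (Fin 3 → ZMod p))
    (hI : Multiset.card I = 9 * p - 3) :
    ∃ T ≤ I, Multiset.card T = 5 * p ∧ T.sum = 0 := by
  classical
  haveI : Fact p.Prime := ⟨hp⟩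
  obtain ⟨S, -, hSc, hS⟩ := exists_five (p := p) (fun x : I.ToType => x.1)
    (by rw [Multiset.card_coe, hI])
  refine ⟨S.val.map (fun x : I.ToType => x.1), ?_, ?_, ?_⟩
  · conv_rhs => rw [← Multiset.map_univ_coe I]
    exact Multiset.map_le_map (Finset.val_le_iff.2 (Finset.subset_univ S))
  · rw [Multiset.card_map]; exact hSc
  · exact hS
end

section
/- Let p be a prime > 7 and J a multiset over (ZMod p)^3 with |J| = 7p - 3, N^p(J) = 0, and N^{2p}(J) ≡ m (mod p). Then N^{3p}(J) ≡ 4m + 20, N^{4p}(J) ≡ 6m + 45, N^{5p}(J) ≡ 4m + 36, and N^{6p}(J) ≡ m + 10 (mod p). Moreover, at most one of m, 4m+20, 6m+45, 4m+36, m+10 is divisible by p. -/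
/-- Number of zero-sum sub-multisets of `J` of cardinality `k`. -/
def N {p : ℕ} (k : ℕ) (J : Multiset (Fin 3 → ZMod p)) : ℕ :=
  (J.powerset.filter (fun T => Multiset.card T = k ∧ T.sum = 0)).card

/-- Functions on subsets of `ι` that are polynomials of degree at most `d` in the indicators. -/
def degSub (K ι : Type) [Field K] [Fintype ι] [DecidableEq ι] (d : ℕ) :
    Submodule K (Finset ι → K) :=
  Submodule.span K {f | ∃ S : Finset ι, S.card ≤ d ∧ f = fun T => if S ⊆ T then 1 else 0}

section deg
variable {K ι : Type} [Field K] [Fintype ι] [DecidableEq ι]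

lemma degSub_mono {d e : ℕ} (h : d ≤ e) : degSub K ι d ≤ degSub K ι e := by
  apply Submodule.span_mono
  rintro f ⟨S, hS, rfl⟩
  exact ⟨S, hS.trans h, rfl⟩

lemma degSub_basic (S : Finset ι) :
    (fun T => if S ⊆ T then 1 else 0 : Finset ι → K) ∈ degSub K ι S.card :=
  Submodule.subset_span ⟨S, le_rfl, rfl⟩

lemma degSub_one : (1 : Finset ι → K) ∈ degSub K ι 0 := by
  have := degSub_basic (K := K) (∅ : Finset ι)
  have e : (1 : Finset ι → K) = fun T => if (∅ : Finset ι) ⊆ T then 1 else 0 := by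
    funext T; simp
  rw [e]
  exact this

lemma degSub_mul {d e : ℕ} {f g : Finset ι → K} (hf : f ∈ degSub K ι d)
    (hg : g ∈ degSub K ι e) : f * g ∈ degSub K ι (d + e) := by
  have h := Submodule.mul_mem_mul hf hg
  unfold degSub at h
  rw [Submodule.span_mul_span] at h
  refine Submodule.span_mono ?_ h
  rintro _ ⟨_, ⟨S, hS, rfl⟩, _, ⟨S', hS', rfl⟩, rfl⟩
  refine ⟨S ∪ S', (Finset.card_union_le _ _).trans (by omega), ?_⟩
  ext T
  simp only [Pi.mul_apply, Finset.union_subset_iff]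
  by_cases h1 : S ⊆ T <;> by_cases h2 : S' ⊆ T <;> simp [h1, h2]

lemma degSub_pow {d : ℕ} {f : Finset ι → K} (hf : f ∈ degSub K ι d) (n : ℕ) :
    f ^ n ∈ degSub K ι (n * d) := by
  induction n with
  | zero => simpa using degSub_one
  | succ n ih =>
    rw [pow_succ, Nat.succ_mul]
    exact degSub_mul ih hf

lemma degSub_lin (a : ι → K) : (fun T => ∑ i ∈ T, a i : Finset ι → K) ∈ degSub K ι 1 := by
  have : (fun T => ∑ i ∈ T, a i : Finset ι → K)
      = ∑ i, a i • (fun T => if {i} ⊆ T then 1 else 0 : Finset ι → K) := by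
    ext T
    simp [Finset.sum_apply]
  rw [this]
  refine Submodule.sum_mem _ fun i _ => Submodule.smul_mem _ _ ?_
  exact degSub_basic ({i} : Finset ι)

lemma degSub_choose (k : ℕ) :
    (fun T => ((T.card.choose k : ℕ) : K) : Finset ι → K) ∈ degSub K ι k := by
  have : (fun T => ((T.card.choose k : ℕ) : K) : Finset ι → K)
      = ∑ S ∈ Finset.powersetCard k Finset.univ,
        (fun T => if S ⊆ T then 1 else 0 : Finset ι → K) := by
    ext T
    rw [Finset.sum_apply, Finset.sum_boole, ← Finset.card_powersetCard]
    congr 2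
    ext S
    simp [Finset.mem_powersetCard, and_comm]
  rw [this]
  refine Submodule.sum_mem _ fun S hS => ?_
  have := degSub_basic (K := K) S
  rwa [(Finset.mem_powersetCard.1 hS).2] at this

lemma degSub_sum {d : ℕ} (hd : d < Fintype.card ι) {f : Finset ι → K}
    (hf : f ∈ degSub K ι d) : ∑ T : Finset ι, (-1 : K) ^ T.card * f T = 0 := by
  induction hf using Submodule.span_induction with
  | mem f h =>
    obtain ⟨S, hS, rfl⟩ := h
    have hne : ∃ i, i ∉ S := by
      by_contra! h
      have : S = Finset.univ := Finset.eq_univ_iff_forall.2 h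
      rw [this, Finset.card_univ] at hS
      omega
    obtain ⟨i, hi⟩ := hne
    have key := Finset.prod_add (fun _ : ι => (-1 : K)) (fun i => if i ∈ S then 0 else 1)
      Finset.univ
    rw [Finset.prod_eq_zero (Finset.mem_univ i) (by simp [hi])] at key
    rw [Finset.powerset_univ] at key
    refine Eq.trans ?_ key.symm
    refine Finset.sum_congr rfl fun T _ => ?_
    rw [Finset.prod_const]
    congr 1
    beta_reduce
    split_ifs with h
    · symm
      apply Finset.prod_eq_one
      intro j hj
      rw [if_neg]
      intro hjS
      exact (Finset.mem_sdiff.1 hj).2 (h hjS)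
    · obtain ⟨j, hjS, hjT⟩ := Finset.not_subset.1 h
      symm
      exact Finset.prod_eq_zero (i := j) (by simp [hjT]) (by simp [hjS])
  | zero => simp
  | add f g _ _ hf hg => simp [mul_add, Finset.sum_add_distrib, hf, hg]
  | smul c f _ hf =>
    simp only [Pi.smul_apply, smul_eq_mul, mul_left_comm _ c]
    rw [← Finset.mul_sum, hf, mul_zero]

end deg

lemma my_powerset_map {α β : Type} (f : α → β) (s : Multiset α) :
    (s.map f).powerset = s.powerset.map (Multiset.map f) := by
  induction s using Multiset.induction with
  | empty => simp
  | cons a s ih => simp [Multiset.powerset_cons, ih]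

lemma my_map_val_powerset {α : Type} (s : Finset α) :
    s.powerset.val.map Finset.val = s.val.powerset := by
  simp [Finset.powerset, Multiset.map_pmap, Multiset.pmap_eq_map]

lemma N_eq {p n : ℕ} (a : Fin n → Fin 3 → ZMod p) (k : ℕ) :
    N k (Finset.univ.val.map a)
      = (Finset.univ.filter fun T : Finset (Fin n) => T.card = k ∧ ∑ i ∈ T, a i = 0).card := by
  unfold N
  rw [my_powerset_map, ← my_map_val_powerset, Multiset.map_map, Multiset.filter_map,
    Multiset.card_map, Finset.powerset_univ, Finset.card_def, Finset.filter_val]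
  congr 1
  apply Multiset.filter_congr
  intro T _
  simp

lemma exists_fin_map {α : Type} (J : Multiset α) :
    ∃ a : Fin (Multiset.card J) → α, J = Finset.univ.val.map a := by
  induction J using Quotient.inductionOn with
  | h l =>
    refine ⟨fun i => l.get i, ?_⟩
    have : List.ofFn (fun i => l.get i) = l := List.ofFn_get l
    change (l : Multiset α) = _
    conv_lhs => rw [← this, List.ofFn_eq_map]
    rfl

lemma key_rel {p n : ℕ} [Fact p.Prime] (hp2 : p ≠ 2) (a : Fin n → Fin 3 → ZMod p)
    (hn : n = 7 * p - 3) (hp7 : 7 < p) (j : ℕ) (hj : j ≤ 3) :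
    ∑ i ∈ Finset.range 7, (-1 : ZMod p) ^ i * (i.choose j : ℕ) *
      (N (i * p) (Finset.univ.val.map a) : ℕ) = 0 := by
  have hpp : p.Prime := Fact.out
  let L : Fin 4 → Finset (Fin n) → ZMod p :=
    Fin.cons (fun T => ∑ i ∈ T, 1) (fun c T => ∑ i ∈ T, a i c)
  have hL : ∀ c, L c ∈ degSub (ZMod p) (Fin n) 1 := by
    intro c
    refine Fin.cases ?_ (fun c => ?_) c
    · exact degSub_lin _
    · exact degSub_lin fun i => a i c
  have hZ : ∀ c, 1 - L c ^ (p - 1) ∈ degSub (ZMod p) (Fin n) (p - 1) := by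
    intro c
    refine Submodule.sub_mem _ (degSub_mono (Nat.zero_le _) degSub_one) ?_
    simpa using degSub_pow (hL c) (p - 1)
  have hP := degSub_mul (degSub_mul (degSub_mul (degSub_mul (hZ 0) (hZ 1)) (hZ 2)) (hZ 3))
    (degSub_choose (K := ZMod p) (ι := Fin n) (j * p))
  have hjp : j * p ≤ 3 * p := Nat.mul_le_mul_right _ hj
  have hs := degSub_sum (by rw [Fintype.card_fin]; omega) hP
  have hval : ∀ x : ZMod p, 1 - x ^ (p - 1) = if x = 0 then 1 else 0 := by
    intro x
    split_ifs with h
    · rw [h, zero_pow (by omega), sub_zero]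
    · rw [ZMod.pow_card_sub_one_eq_one h, sub_self]
  let F := Finset.univ.filter fun T : Finset (Fin n) => p ∣ T.card ∧ ∑ i ∈ T, a i = 0
  have hs2 : ∑ T ∈ F, (-1 : ZMod p) ^ T.card * (T.card.choose (j * p) : ℕ) = 0 := by
    rw [← hs, Finset.sum_filter]
    refine Finset.sum_congr rfl fun T _ => ?_
    have h0 : L 0 T = (T.card : ZMod p) := by simp [L]
    have h1 : L 1 T = (∑ i ∈ T, a i) 0 := by rw [Finset.sum_apply]; rfl
    have h2 : L 2 T = (∑ i ∈ T, a i) 1 := by rw [Finset.sum_apply]; rfl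
    have h3 : L 3 T = (∑ i ∈ T, a i) 2 := by rw [Finset.sum_apply]; rfl
    simp only [Pi.mul_apply, Pi.sub_apply, Pi.pow_apply, Pi.one_apply, hval, h0, h1, h2, h3]
    generalize (∑ i ∈ T, a i) = v
    have hv : v = 0 ↔ v 0 = 0 ∧ v 1 = 0 ∧ v 2 = 0 := by
      rw [funext_iff, Fin.forall_fin_succ, Fin.forall_fin_succ, Fin.forall_fin_succ]
      simp
    simp only [hv, ← ZMod.natCast_eq_zero_iff]
    by_cases g0 : (T.card : ZMod p) = 0 <;> by_cases g1 : v 0 = 0 <;>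
      by_cases g2 : v 1 = 0 <;> by_cases g3 : v 2 = 0 <;> simp [g0, g1, g2, g3]
  have hmaps : ∀ T ∈ F, T.card / p ∈ Finset.range 7 := by
    intro T _
    rw [Finset.mem_range, Nat.div_lt_iff_lt_mul hpp.pos]
    have := Finset.card_le_univ T
    rw [Fintype.card_fin] at this
    omega
  rw [← Finset.sum_fiberwise_of_maps_to hmaps] at hs2
  rw [← hs2]
  refine Finset.sum_congr rfl fun i _ => ?_
  have hset : (F.filter fun T => T.card / p = i)
      = Finset.univ.filter fun T : Finset (Fin n) => T.card = i * p ∧ ∑ i ∈ T, a i = 0 := by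
    ext T
    simp only [F, Finset.mem_filter, Finset.mem_univ, true_and]
    constructor
    · rintro ⟨⟨h1, h2⟩, h3⟩
      exact ⟨by rw [← h3, Nat.div_mul_cancel h1], h2⟩
    · rintro ⟨h1, h2⟩
      exact ⟨⟨⟨i, by rw [h1, mul_comm]⟩, h2⟩, by rw [h1, Nat.mul_div_cancel _ hpp.pos]⟩
  rw [hset, N_eq]
  have hc : (((i * p).choose (j * p) : ℕ) : ZMod p) = (i.choose j : ℕ) := by
    rw [ZMod.natCast_eq_natCast_iff]
    have := Choose.choose_modEq_choose_mod_mul_choose_div_nat (n := i * p) (k := j * p) (p := p)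
    simpa [Nat.mul_div_cancel _ hpp.pos] using this
  have hodd : Odd p := hpp.odd_of_ne_two hp2
  have hsum : ∀ T ∈ Finset.univ.filter
      (fun T : Finset (Fin n) => T.card = i * p ∧ ∑ i ∈ T, a i = 0),
      (-1 : ZMod p) ^ T.card * (T.card.choose (j * p) : ℕ) = (-1) ^ i * (i.choose j : ℕ) := by
    intro T hT
    rw [(Finset.mem_filter.1 hT).2.1, hc, mul_comm i p, pow_mul, hodd.neg_one_pow]
  rw [Finset.sum_congr rfl hsum, Finset.sum_const, nsmul_eq_mul, mul_comm]

lemma N_zero {p : ℕ} (J : Multiset (Fin 3 → ZMod p)) : N 0 J = 1 := by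
  obtain ⟨a, h⟩ := exists_fin_map J
  rw [h, N_eq, Finset.card_eq_one]
  refine ⟨∅, ?_⟩
  ext T
  simp only [Finset.mem_filter, Finset.mem_univ, true_and, Finset.card_eq_zero,
    Finset.mem_singleton]
  constructor
  · exact fun h => h.1
  · rintro rfl; simp

theorem stmt_14 (p : ℕ) (hp : p.Prime) (hp7 : 7 < p)
    (J : Multiset (Fin 3 → ZMod p)) (hJ : Multiset.card J = 7 * p - 3)
    (h1 : N p J = 0) (m : ℤ) (h2 : (N (2 * p) J : ℤ) ≡ m [ZMOD p]) :
    ((N (3 * p) J : ℤ) ≡ 4 * m + 20 [ZMOD p] ∧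
     (N (4 * p) J : ℤ) ≡ 6 * m + 45 [ZMOD p] ∧
     (N (5 * p) J : ℤ) ≡ 4 * m + 36 [ZMOD p] ∧
     (N (6 * p) J : ℤ) ≡ m + 10 [ZMOD p]) ∧
    ∀ i j : Fin 5, i ≠ j →
      ¬((p : ℤ) ∣ ![m, 4 * m + 20, 6 * m + 45, 4 * m + 36, m + 10] i ∧
        (p : ℤ) ∣ ![m, 4 * m + 20, 6 * m + 45, 4 * m + 36, m + 10] j) := by
  have : Fact p.Prime := ⟨hp⟩
  constructor
  · obtain ⟨a, ha⟩ := exists_fin_map J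
    have K := fun j hj => key_rel (by omega) a hJ hp7 j hj
    rw [← ha] at K
    have k0 := K 0 (by norm_num)
    have k1 := K 1 (by norm_num)
    have k2 := K 2 (by norm_num)
    have k3 := K 3 (by norm_num)
    simp only [← ZMod.intCast_eq_intCast_iff] at h2 ⊢
    push_cast at h2 ⊢
    simp [Finset.sum_range_succ, N_zero, h1, h2, Nat.choose] at k0 k1 k2 k3
    generalize (N (3 * p) J : ZMod p) = x3 at *
    generalize (N (4 * p) J : ZMod p) = x4 at *
    generalize (N (5 * p) J : ZMod p) = x5 at *
    generalize (N (6 * p) J : ZMod p) = x6 at *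
    refine ⟨?_, ?_, ?_, ?_⟩
    · linear_combination -(20 * k0 - 10 * k1 + 4 * k2 - k3)
    · linear_combination -45 * k0 + 25 * k1 - 11 * k2 + 3 * k3
    · linear_combination -(36 * k0 - 21 * k1 + 10 * k2 - 3 * k3)
    · linear_combination -10 * k0 + 6 * k1 - 3 * k2 + k3
  · have hP : Prime (p : ℤ) := Nat.prime_iff_prime_int.1 hp
    have hsmall : ∀ q : ℤ, 0 < q → q ≤ 7 → ¬ (p : ℤ) ∣ q := by
      intro q h0 h7 hd
      have := Int.le_of_dvd h0 hd
      omega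
    have n2 := hsmall 2 (by norm_num) (by norm_num)
    have n3 := hsmall 3 (by norm_num) (by norm_num)
    have n5 := hsmall 5 (by norm_num) (by norm_num)
    have hno : ¬ (p : ℤ) ∣ 720 := by
      intro h
      rw [show (720 : ℤ) = 2 ^ 4 * 3 ^ 2 * 5 by norm_num] at h
      rcases hP.dvd_or_dvd h with h | h
      · rcases hP.dvd_or_dvd h with h | h
        · exact n2 (hP.dvd_of_dvd_pow h)
        · exact n3 (hP.dvd_of_dvd_pow h)
      · exact n5 h
    have hlt : ∀ i j : Fin 5, i < j →
      ¬((p : ℤ) ∣ ![m, 4 * m + 20, 6 * m + 45, 4 * m + 36, m + 10] i ∧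
        (p : ℤ) ∣ ![m, 4 * m + 20, 6 * m + 45, 4 * m + 36, m + 10] j) := by
      rintro i j hij ⟨⟨u, hu⟩, ⟨v, hv⟩⟩
      apply hno
      fin_cases i <;> fin_cases j <;> simp at hij hu hv
      · exact ⟨36 * (v - 4 * u), by linear_combination 36 * (hv - 4 * hu)⟩
      · exact ⟨16 * (v - 6 * u), by linear_combination 16 * (hv - 6 * hu)⟩
      · exact ⟨20 * (v - 4 * u), by linear_combination 20 * (hv - 4 * hu)⟩
      · exact ⟨72 * (v - u), by linear_combination 72 * (hv - hu)⟩
      · exact ⟨24 * (2 * v - 3 * u), by linear_combination 24 * (2 * hv - 3 * hu)⟩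
      · exact ⟨45 * (v - u), by linear_combination 45 * (hv - hu)⟩
      · exact ⟨36 * (4 * v - u), by linear_combination 36 * (4 * hv - hu)⟩
      · exact ⟨40 * (3 * v - 2 * u), by linear_combination 40 * (3 * hv - 2 * hu)⟩
      · exact ⟨48 * (6 * v - u), by linear_combination 48 * (6 * hv - hu)⟩
      · exact ⟨180 * (4 * v - u), by linear_combination 180 * (4 * hv - hu)⟩
    intro i j hij hd
    rcases lt_or_gt_of_ne hij with h | h
    · exact hlt i j h hd
    · exact hlt j i h ⟨hd.2, hd.1⟩
end

section
/- Let p be a prime > 7 and J a multiset over (ZMod p)^3 with |J| = 7p - 3 such that there exists a fixed residue c with N^{2p}(I) ≡ c (mod p) for every sub-multiset I of J of cardinality 4p - 3. Then J has a zero-sum sub-multiset of cardinality p. -/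
open Finset

namespace Kem

/-- `F` has degree at most `d` as a function on subsets: alternating sums vanish. -/
def Deg {ι R : Type*} [CommRing R] (d : ℕ) (F : Finset ι → R) : Prop :=
  ∀ S : Finset ι, d < S.card → ∑ T ∈ S.powerset, (-1 : R) ^ T.card * F T = 0

variable {ι R : Type*} [DecidableEq ι] [CommRing R]


lemma deg_one : Deg 0 (fun _ : Finset ι => (1 : R)) := by
  intro S hS
  have h := Finset.sum_powerset_neg_one_pow_card_of_nonempty (Finset.card_pos.mp hS)
  have h2 := congrArg (Int.cast : ℤ → R) h
  push_cast at h2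
  simpa using h2

lemma deg_mono {d e : ℕ} (h : d ≤ e) {F : Finset ι → R} (hF : Deg d F) : Deg e F :=
  fun S hS => hF S (lt_of_le_of_lt h hS)

lemma deg_sub {d : ℕ} {F G : Finset ι → R} (hF : Deg d F) (hG : Deg d G) :
    Deg d (fun T => F T - G T) := by
  intro S hS
  simp only [mul_sub, Finset.sum_sub_distrib]
  rw [hF S hS, hG S hS, sub_zero]

lemma deg_lin {d : ℕ} {F : Finset ι → R} (hF : Deg d F) (w : ι → R) :
    Deg (d + 1) (fun T => (∑ i ∈ T, w i) * F T) := by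
  intro S hS
  have key : ∀ i ∈ S, ∑ T ∈ S.powerset, (if i ∈ T then (-1 : R) ^ T.card * F T else 0) = 0 := by
    intro i hi
    have h1 := hF S (by omega)
    have h2 := hF (S.erase i) (by rw [Finset.card_erase_of_mem hi]; omega)
    rw [← Finset.sum_filter]
    rw [← Finset.sum_filter_add_sum_filter_not _ (fun T => i ∈ T)] at h1
    have h3 : S.powerset.filter (fun T => i ∉ T) = (S.erase i).powerset := by
      ext T
      simp only [Finset.mem_filter, Finset.mem_powerset, Finset.subset_erase]
    rw [h3, h2, add_zero] at h1
    exact h1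
  calc ∑ T ∈ S.powerset, (-1 : R) ^ T.card * ((∑ i ∈ T, w i) * F T)
      = ∑ T ∈ S.powerset, ∑ i ∈ S, w i * (if i ∈ T then (-1 : R) ^ T.card * F T else 0) := by
        refine Finset.sum_congr rfl fun T hT => ?_
        have hTS := Finset.mem_powerset.mp hT
        rw [Finset.sum_mul, Finset.mul_sum]
        rw [← Finset.sum_subset hTS]
        · refine Finset.sum_congr rfl fun i hi => ?_
          rw [if_pos hi]; ring
        · intro i _ hi
          rw [if_neg hi, mul_zero]
    _ = ∑ i ∈ S, w i * ∑ T ∈ S.powerset, (if i ∈ T then (-1 : R) ^ T.card * F T else 0) := by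
        rw [Finset.sum_comm]
        simp only [Finset.mul_sum]
    _ = 0 := Finset.sum_eq_zero fun i hi => by rw [key i hi, mul_zero]

lemma deg_pow {d : ℕ} {F : Finset ι → R} (hF : Deg d F) (w : ι → R) (k : ℕ) :
    Deg (d + k) (fun T => (∑ i ∈ T, w i) ^ k * F T) := by
  induction k with
  | zero => simpa using hF
  | succ k ih =>
    have := deg_lin ih w
    simpa only [pow_succ', mul_assoc, add_assoc] using this

lemma deg_ind {d : ℕ} {F : Finset ι → R} (hF : Deg d F) (w : ι → R) (k : ℕ) :
    Deg (d + k) (fun T => (1 - (∑ i ∈ T, w i) ^ k) * F T) := by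
  have := deg_sub (deg_mono (Nat.le_add_right d k) hF) (deg_pow hF w k)
  simpa only [sub_mul, one_mul] using this

variable {p : ℕ}

/-- Number of zero-sum `k`-subsets of the index set `S`. -/
def Nn (a : ι → Fin 3 → ZMod p) (k : ℕ) (S : Finset ι) : ℕ :=
  ((S.powersetCard k).filter (fun T => ∑ i ∈ T, a i = 0)).card

lemma one_sub_pow [Fact p.Prime] (x : ZMod p) : 1 - x ^ (p - 1) = if x = 0 then 1 else 0 := by
  have hp := (Fact.out : p.Prime).two_le
  split_ifs with h
  · rw [h, zero_pow (by omega), sub_zero]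
  · rw [ZMod.pow_card_sub_one_eq_one h, sub_self]

lemma cw [Fact p.Prime] (a : ι → Fin 3 → ZMod p) (S : Finset ι) (hS : 4 * p - 3 ≤ S.card) :
    ∑ T ∈ S.powerset, (-1 : ZMod p) ^ T.card *
      (if p ∣ T.card ∧ ∑ i ∈ T, a i = 0 then 1 else 0) = 0 := by
  have hp := (Fact.out : p.Prime).two_le
  have h : Deg (0 + (p - 1) + (p - 1) + (p - 1) + (p - 1)) _ :=
    deg_ind (deg_ind (deg_ind (deg_ind (deg_one (ι := ι) (R := ZMod p))
    (fun i => a i 0) (p - 1)) (fun i => a i 1) (p - 1)) (fun i => a i 2) (p - 1))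
    (fun _ => 1) (p - 1)
  have h := h S (by omega)
  refine Eq.trans (Finset.sum_congr rfl fun T _ => congrArg _ ?_) h
  beta_reduce
  rw [one_sub_pow, one_sub_pow, one_sub_pow, one_sub_pow]
  have e1 : (∑ i ∈ T, (1 : ZMod p)) = 0 ↔ p ∣ T.card := by
    rw [Finset.sum_const, nsmul_eq_mul, mul_one]
    exact ZMod.natCast_eq_zero_iff _ _
  have e2 : (∑ i ∈ T, a i = 0) ↔
      (∑ i ∈ T, a i 0 = 0) ∧ (∑ i ∈ T, a i 1 = 0) ∧ (∑ i ∈ T, a i 2 = 0) := by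
    constructor
    · intro h
      exact ⟨by simpa using congrFun h 0, by simpa using congrFun h 1, by simpa using congrFun h 2⟩
    · rintro ⟨h0, h1, h2⟩
      funext k
      fin_cases k
      · simpa using h0
      · simpa using h1
      · simpa using h2
  rw [if_congr e1 rfl rfl, if_congr (and_congr Iff.rfl e2) rfl rfl]
  generalize (∑ i ∈ T, a i 0) = x
  generalize (∑ i ∈ T, a i 1) = y
  generalize (∑ i ∈ T, a i 2) = z
  by_cases hx : x = 0 <;> by_cases hy : y = 0 <;> by_cases hz : z = 0 <;>
    by_cases hd : p ∣ T.card <;> simp [hx, hy, hz, hd]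

lemma rel [Fact p.Prime] (hodd : Odd p) (a : ι → Fin 3 → ZMod p) (S : Finset ι)
    (hS : 4 * p - 3 ≤ S.card) (hS' : S.card < 7 * p) :
    ∑ j ∈ range 7, (-1 : ZMod p) ^ j * (Nn a (j * p) S : ZMod p) = 0 := by
  have hp := (Fact.out : p.Prime).two_le
  rw [← cw a S hS]
  have h1 : ∀ j, (Nn a (j * p) S : ZMod p) =
      ∑ T ∈ S.powerset, if T.card = j * p ∧ ∑ i ∈ T, a i = 0 then 1 else 0 := by
    intro j
    rw [Nn, Finset.sum_boole]
    congr 2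
    ext T
    simp only [mem_filter, mem_powersetCard, mem_powerset, and_assoc]
  simp only [h1, Finset.mul_sum]
  rw [Finset.sum_comm]
  refine Finset.sum_congr rfl fun T hT => ?_
  have hTc := Finset.card_le_card (Finset.mem_powerset.mp hT)
  by_cases hd : p ∣ T.card
  · obtain ⟨q, hq⟩ := hd
    have hq7 : q < 7 := by
      by_contra hcon
      have : p * 7 ≤ p * q := Nat.mul_le_mul_left p (by omega)
      omega
    rw [Finset.sum_eq_single q]
    · rw [hq, pow_mul, hodd.neg_one_pow, mul_comm p q]
      simp
    · intro j _ hj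
      rw [if_neg, mul_zero]
      rintro ⟨h, _⟩
      rw [hq, mul_comm] at h
      exact hj (Nat.eq_of_mul_eq_mul_right (by omega) h).symm
    · intro hh
      exact absurd (Finset.mem_range.mpr hq7) hh
  · rw [if_neg (fun h => hd h.1), mul_zero]
    refine Finset.sum_eq_zero fun j _ => ?_
    rw [if_neg, mul_zero]
    rintro ⟨h, _⟩
    exact hd ⟨j, by rw [h, mul_comm]⟩

lemma Nn_zero_of_card_lt (a : ι → Fin 3 → ZMod p) (k : ℕ) (S : Finset ι) (h : S.card < k) :
    Nn a k S = 0 := by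
  rw [Nn, Finset.powersetCard_eq_empty.mpr h]; simp

lemma Nn_zero (a : ι → Fin 3 → ZMod p) (S : Finset ι) : Nn a 0 S = 1 := by
  simp [Nn, Finset.filter_singleton]

lemma Nn_eq_zero (a : ι → Fin 3 → ZMod p) (k : ℕ) (S : Finset ι)
    (h : ∀ T ⊆ S, T.card = k → ∑ i ∈ T, a i = 0 → False) : Nn a k S = 0 := by
  rw [Nn, Finset.card_eq_zero, Finset.filter_eq_empty_iff]
  intro T hT hs
  rw [Finset.mem_powersetCard] at hT
  exact h T hT.1 hT.2 hs

lemma card_between (S T : Finset ι) (hT : T ⊆ S) (m : ℕ) (hm : T.card ≤ m) :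
    ((S.powersetCard m).filter (fun I => T ⊆ I)).card = (S.card - T.card).choose (m - T.card) := by
  rw [← Finset.card_sdiff_of_subset hT, ← Finset.card_powersetCard]
  refine Finset.card_bij' (fun I _ => I \ T) (fun U _ => U ∪ T) ?_ ?_ ?_ ?_
  · intro I hI
    simp only [mem_filter, mem_powersetCard] at hI ⊢
    refine ⟨Finset.sdiff_subset_sdiff hI.1.1 le_rfl, ?_⟩
    rw [Finset.card_sdiff_of_subset hI.2, hI.1.2]
  · intro U hU
    simp only [mem_filter, mem_powersetCard] at hU ⊢
    have hd : Disjoint U T := Finset.disjoint_of_subset_left hU.1 Finset.sdiff_disjoint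
    refine ⟨⟨Finset.union_subset (hU.1.trans Finset.sdiff_subset) hT, ?_⟩,
      Finset.subset_union_right⟩
    rw [Finset.card_union_of_disjoint hd, hU.2]; omega
  · intro I hI
    simp only [mem_filter] at hI
    exact Finset.sdiff_union_of_subset hI.2
  · intro U hU
    simp only [mem_powersetCard] at hU
    have hd : Disjoint U T := Finset.disjoint_of_subset_left hU.1 Finset.sdiff_disjoint
    rw [Finset.union_sdiff_right]
    exact Finset.sdiff_eq_self_of_disjoint hd

lemma avg_nat (a : ι → Fin 3 → ZMod p) (k m : ℕ) (hkm : k ≤ m) (S : Finset ι) :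
    ∑ I ∈ S.powersetCard m, Nn a k I = (S.card - k).choose (m - k) * Nn a k S := by
  have h1 : ∀ I ∈ S.powersetCard m, Nn a k I =
      ∑ T ∈ (S.powersetCard k).filter (fun T => ∑ i ∈ T, a i = 0), if T ⊆ I then 1 else 0 := by
    intro I hI
    rw [Finset.sum_boole, Nn, Nat.cast_id]
    congr 1
    ext T
    simp only [mem_filter, mem_powersetCard] at hI ⊢
    constructor
    · rintro ⟨⟨h1, h2⟩, h3⟩
      exact ⟨⟨⟨h1.trans hI.1, h2⟩, h3⟩, h1⟩
    · rintro ⟨⟨⟨h1, h2⟩, h3⟩, h4⟩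
      exact ⟨⟨h4, h2⟩, h3⟩
  rw [Finset.sum_congr rfl h1, Finset.sum_comm]
  rw [Finset.sum_congr rfl (g := fun _ => (S.card - k).choose (m - k))]
  · rw [Finset.sum_const, smul_eq_mul, mul_comm, Nn]
  · intro T hT
    simp only [mem_filter, mem_powersetCard] at hT
    rw [Finset.sum_boole, Nat.cast_id, card_between S T hT.1.1 m (by omega), hT.1.2]

lemma lucas [Fact p.Prime] (hp3 : 3 < p) (A B : ℕ) :
    ((A * p + (p - 3)).choose (B * p) : ZMod p) = (A.choose B : ZMod p) := by
  have h := Choose.choose_modEq_choose_mod_mul_choose_div_nat (n := A * p + (p - 3))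
    (k := B * p) (p := p)
  have e1 : (A * p + (p - 3)) / p = A := by
    rw [mul_comm, Nat.mul_add_div (by omega), Nat.div_eq_of_lt (by omega), add_zero]
  have e2 : B * p / p = B := Nat.mul_div_cancel _ (by omega)
  rw [e1, e2, Nat.mul_mod_left, Nat.choose_zero_right, one_mul] at h
  exact (ZMod.natCast_eq_natCast_iff _ _ _).mpr h

lemma avg [Fact p.Prime] (hp3 : 3 < p) (a : ι → Fin 3 → ZMod p) (S : Finset ι) (s r j : ℕ)
    (hrs : r ≤ s) (hS : S.card = s * p + (p - 3)) :
    ∑ I ∈ S.powersetCard (r * p + (p - 3)), (Nn a (j * p) I : ZMod p) =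
      ((s - j).choose (s - r) : ZMod p) * (Nn a (j * p) S : ZMod p) := by
  have lt_of : ∀ x, x < j → x * p + (p - 3) < j * p := by
    intro x hx
    have : (x + 1) * p ≤ j * p := Nat.mul_le_mul_right p hx
    rw [add_mul] at this
    omega
  rcases le_or_gt j r with hj | hj
  · have h1 : j * p ≤ r * p := Nat.mul_le_mul_right p hj
    have h2 : r * p ≤ s * p := Nat.mul_le_mul_right p hrs
    rw [← Nat.cast_sum, avg_nat a (j * p) _ (by omega), Nat.cast_mul]
    congr 1
    rw [← lucas hp3 (s - j) (s - r), hS]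
    have e1 : s * p + (p - 3) - j * p = (s - j) * p + (p - 3) := by
      rw [Nat.sub_mul]; omega
    rw [e1]
    congr 1
    apply Nat.choose_symm_of_eq_add
    rw [Nat.sub_mul, Nat.sub_mul]; omega
  · rw [Finset.sum_eq_zero]
    · rcases le_or_gt j s with hjs | hjs
      · rw [Nat.choose_eq_zero_of_lt (by omega)]; simp
      · rw [Nn_zero_of_card_lt a _ S (by rw [hS]; exact lt_of s hjs)]; simp
    · intro I hI
      rw [Finset.mem_powersetCard] at hI
      rw [Nn_zero_of_card_lt a _ I (by rw [hI.2]; exact lt_of r hj)]; simp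

lemma rel_avg [Fact p.Prime] (hodd : Odd p) (hp3 : 3 < p) (a : ι → Fin 3 → ZMod p)
    (S : Finset ι) (s r : ℕ) (hr3 : 3 ≤ r) (hr6 : r ≤ 6)
    (hrs : r ≤ s) (hS : S.card = s * p + (p - 3)) :
    ∑ j ∈ range 7, (-1 : ZMod p) ^ j *
      (((s - j).choose (s - r) : ZMod p) * (Nn a (j * p) S : ZMod p)) = 0 := by
  simp only [← avg hp3 a S s r _ hrs hS, Finset.mul_sum]
  rw [Finset.sum_comm]
  refine Finset.sum_eq_zero fun I hI => ?_
  rw [Finset.mem_powersetCard] at hI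
  have h1 : 3 * p ≤ r * p := Nat.mul_le_mul_right p hr3
  have h2 : r * p ≤ 6 * p := Nat.mul_le_mul_right p hr6
  exact rel hodd a I (by omega) (by omega)

lemma compl_zero (a : ι → Fin 3 → ZMod p) (T U : Finset ι) (hU : U ⊆ T)
    (hT : ∑ i ∈ T, a i = 0) (hU0 : ∑ i ∈ U, a i = 0) : ∑ i ∈ T \ U, a i = 0 := by
  have := Finset.sum_sdiff (f := a) hU
  rw [hU0, hT, add_zero] at this
  exact this

lemma small_ne [Fact p.Prime] (n : ℕ) (hn : 0 < n) (hnp : n < p) : (n : ZMod p) ≠ 0 := by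
  intro h
  rw [ZMod.natCast_eq_zero_iff] at h
  exact absurd (Nat.le_of_dvd hn h) (by omega)

lemma exists_of_Nn_ne (a : ι → Fin 3 → ZMod p) (k : ℕ) (S : Finset ι)
    (h : (Nn a k S : ZMod p) ≠ 0) : ∃ T ⊆ S, T.card = k ∧ ∑ i ∈ T, a i = 0 := by
  by_contra hcon
  push Not at hcon
  exact h (by rw [Nn_eq_zero a k S fun T h1 h2 h3 => hcon T h1 h2 h3]; simp)

theorem main [Fact p.Prime] (hp7 : 7 < p) (a : ι → Fin 3 → ZMod p) (S : Finset ι)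
    (hS : S.card = 7 * p - 3) (c : ZMod p)
    (hc : ∀ I ⊆ S, I.card = 4 * p - 3 → (Nn a (2 * p) I : ZMod p) = c) :
    ∃ T ⊆ S, T.card = p ∧ ∑ i ∈ T, a i = 0 := by
  by_contra hno
  push Not at hno
  have hprime : p.Prime := Fact.out
  have hodd : Odd p := hprime.odd_of_ne_two (by omega)
  have hp3 : 3 < p := by omega
  have n2 : (2 : ZMod p) ≠ 0 := by exact_mod_cast small_ne (p := p) 2 (by omega) (by omega)
  have n3 : (3 : ZMod p) ≠ 0 := by exact_mod_cast small_ne (p := p) 3 (by omega) (by omega)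
  have n5 : (5 : ZMod p) ≠ 0 := by exact_mod_cast small_ne (p := p) 5 (by omega) (by omega)
  have N1 : ∀ I ⊆ S, Nn a p I = 0 := fun I hI =>
    Nn_eq_zero a p I fun T h1 h2 h3 => hno T (h1.trans hI) h2 h3
  -- average of the number of zero-sum `2p`-subsets
  have avg2 : ∀ K ⊆ S, ∀ s, 3 ≤ s → K.card = s * p + (p - 3) →
      ((s - 2).choose (s - 3) : ZMod p) * (Nn a (2 * p) K : ZMod p) =
        (s.choose (s - 3) : ZMod p) * c := by
    intro K hK s hs hKc
    have h0 := avg hp3 a K s 3 0 hs hKc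
    have h2 := avg hp3 a K s 3 2 hs hKc
    rw [← h2]
    simp only [zero_mul, Nn_zero, Nat.cast_one, mul_one, Nat.sub_zero] at h0
    rw [← h0, Finset.sum_mul]
    refine Finset.sum_congr rfl fun I hI => ?_
    rw [Finset.mem_powersetCard] at hI
    rw [hc I (hI.1.trans hK) (by omega), one_mul]
  -- a zero-sum `4p`-subset forces `c = -1`
  have H4 : ∀ T ⊆ S, T.card = 4 * p → ∑ i ∈ T, a i = 0 → 1 + c = 0 := by
    intro T hT hTc hT0
    obtain ⟨I, hI, hIc⟩ := Finset.exists_subset_card_eq (s := T) (n := 4 * p - 3) (by omega)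
    have hr := rel hodd a I (by omega) (by omega)
    have h3 : Nn a (3 * p) I = 0 := Nn_eq_zero a _ I fun U h1 h2 h3 =>
      hno (T \ U) (Finset.sdiff_subset.trans hT)
        (by rw [Finset.card_sdiff_of_subset (h1.trans hI)]; omega)
        (compl_zero a T U (h1.trans hI) hT0 h3)
    simp [Finset.sum_range_succ, Nn_zero, N1 I (hI.trans hT), hc I (hI.trans hT) hIc, h3,
      Nn_zero_of_card_lt a (4 * p) I (by omega), Nn_zero_of_card_lt a (5 * p) I (by omega),
      Nn_zero_of_card_lt a (6 * p) I (by omega)] at hr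
    exact hr
  -- a zero-sum `5p`-subset forces `2c = -3`
  have H5 : ∀ T ⊆ S, T.card = 5 * p → ∑ i ∈ T, a i = 0 → 3 + 2 * c = 0 := by
    intro T hT hTc hT0
    obtain ⟨K, hK, hKc⟩ := Finset.exists_subset_card_eq (s := T) (n := 5 * p - 3) (by omega)
    have h4 : Nn a (4 * p) K = 0 := Nn_eq_zero a _ K fun U h1 h2 h3 =>
      hno (T \ U) (Finset.sdiff_subset.trans hT)
        (by rw [Finset.card_sdiff_of_subset (h1.trans hK)]; omega)
        (compl_zero a T U (h1.trans hK) hT0 h3)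
    have hr := rel hodd a K (by omega) (by omega)
    have hr3 := rel_avg hodd hp3 a K 4 3 (by omega) (by omega) (by omega) (by omega)
    have h2 := avg2 K (hK.trans hT) 4 (by omega) (by omega)
    simp [Finset.sum_range_succ, Nn_zero, N1 K (hK.trans hT), h4, Nat.choose,
      Nn_zero_of_card_lt a (5 * p) K (by omega),
      Nn_zero_of_card_lt a (6 * p) K (by omega)] at hr hr3 h2
    have h2' : (Nn a (2 * p) K : ZMod p) = 2 * c := by
      apply mul_left_cancel₀ n2
      linear_combination h2
    linear_combination hr3 - hr - h2'
  -- relations on all of `S`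
  have hS' : S.card = 6 * p + (p - 3) := by omega
  have g2 := avg2 S le_rfl 6 (by omega) hS'
  have r3 := rel_avg hodd hp3 a S 6 3 (by omega) (by omega) (by omega) hS'
  have r4 := rel_avg hodd hp3 a S 6 4 (by omega) (by omega) (by omega) hS'
  have r5 := rel_avg hodd hp3 a S 6 5 (by omega) (by omega) (by omega) hS'
  have r6 := rel_avg hodd hp3 a S 6 6 (by omega) (by omega) (by omega) hS'
  simp [Finset.sum_range_succ, Nn_zero, N1 S le_rfl, Nat.choose] at g2 r3 r4 r5 r6
  have n4 : (4 : ZMod p) ≠ 0 := by exact_mod_cast small_ne (p := p) 4 (by omega) (by omega)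
  have g2' : (Nn a (2 * p) S : ZMod p) = 5 * c := by
    apply mul_left_cancel₀ n4
    linear_combination g2
  have g3 : (Nn a (3 * p) S : ZMod p) = 20 + 20 * c := by
    linear_combination 4 * g2' - r3
  have g4 : (Nn a (4 * p) S : ZMod p) = 45 + 30 * c := by
    linear_combination r4 - 6 * g2' + 3 * g3
  have g5 : (Nn a (5 * p) S : ZMod p) = 36 + 20 * c := by
    linear_combination 4 * g2' - 3 * g3 + 2 * g4 - r5
  have g6 : (Nn a (6 * p) S : ZMod p) = 10 + 5 * c := by
    linear_combination r6 - g2' + g3 - g4 + g5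
  by_cases hex : ∃ T ⊆ S, T.card = 4 * p ∧ ∑ i ∈ T, a i = 0
  · obtain ⟨T, hT, hTc, hT0⟩ := hex
    have hc1 := H4 T hT hTc hT0
    obtain ⟨T', hT', hTc', hT0'⟩ := exists_of_Nn_ne a (5 * p) S (by
      rw [g5]
      intro h
      have : (2 : ZMod p) ^ 4 = 0 := by linear_combination h - 20 * hc1
      exact n2 (pow_eq_zero_iff (by norm_num) |>.mp this))
    have hc2 := H5 T' hT' hTc' hT0'
    have : (1 : ZMod p) = 0 := by linear_combination hc2 - 2 * hc1
    exact one_ne_zero this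
  · push Not at hex
    have h40 : Nn a (4 * p) S = 0 := Nn_eq_zero a _ S fun T h1 h2 h3 => hex T h1 h2 h3
    rw [h40, Nat.cast_zero] at g4
    have hc1 : 3 + 2 * c = 0 := by
      apply mul_left_cancel₀ n5
      apply mul_left_cancel₀ n3
      linear_combination -g4
    obtain ⟨T, hT, hTc, hT0⟩ := exists_of_Nn_ne a (6 * p) S (by
      rw [g6]
      intro h
      exact n5 (by linear_combination 2 * h - 5 * hc1))
    obtain ⟨I, hI, hIc⟩ := Finset.exists_subset_card_eq (s := T) (n := 4 * p - 3) (by omega)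
    have h2 : Nn a (2 * p) I = 0 := Nn_eq_zero a _ I fun U h1 h2 h3 =>
      hex (T \ U) (Finset.sdiff_subset.trans hT)
        (by rw [Finset.card_sdiff_of_subset (h1.trans hI)]; omega)
        (compl_zero a T U (h1.trans hI) hT0 h3)
    have hc0 := hc I (hI.trans hT) hIc
    rw [h2, Nat.cast_zero] at hc0
    exact n3 (by linear_combination hc1 + 2 * hc0)

lemma powerset_map' {α β : Type*} (f : α → β) (s : Multiset α) :
    (s.map f).powerset = s.powerset.map (Multiset.map f) := by
  induction s using Multiset.induction with
  | empty => simp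
  | cons x s ih => simp [Multiset.powerset_cons, ih, Multiset.map_map, Function.comp_def]

lemma powerset_val' {α : Type*} (S : Finset α) :
    S.val.powerset = S.powerset.val.map Finset.val := by
  simp [Finset.powerset, Multiset.map_pmap, Multiset.pmap_eq_map]

lemma N_eq (a : ι → Fin 3 → ZMod p) (k : ℕ) (S : Finset ι) :
    N k (S.val.map a) = Nn a k S := by
  rw [N, powerset_map', powerset_val', Multiset.map_map, Multiset.filter_map, Multiset.card_map,
    Nn, Finset.card_def]
  have : (S.powersetCard k).filter (fun T => ∑ i ∈ T, a i = 0) =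
      S.powerset.filter (fun T => T.card = k ∧ ∑ i ∈ T, a i = 0) := by
    ext T
    simp only [mem_filter, mem_powersetCard, mem_powerset, and_assoc]
  rw [this, Finset.filter_val]
  congr 1
  apply Multiset.filter_congr
  intro T _
  change (Multiset.map a T.val).card = k ∧ (T.val.map a).sum = 0 ↔ _
  rw [Multiset.card_map]
  rfl

end Kem

theorem stmt_18 (p : ℕ) (hp : p.Prime) (hp7 : 7 < p)
    (J : Multiset (Fin 3 → ZMod p)) (hJ : Multiset.card J = 7 * p - 3)
    (h : ∃ c : ℤ, ∀ I ≤ J, Multiset.card I = 4 * p - 3 →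
      (N (2 * p) I : ℤ) ≡ c [ZMOD p]) :
    ∃ T ≤ J, Multiset.card T = p ∧ T.sum = 0 := by
  haveI : Fact p.Prime := ⟨hp⟩
  obtain ⟨c, hc⟩ := h
  obtain ⟨n, a, rfl⟩ : ∃ (n : ℕ) (a : Fin n → Fin 3 → ZMod p),
      J = (Finset.univ : Finset (Fin n)).val.map a := by
    induction J using Quotient.inductionOn with
    | h l => exact ⟨l.length, l.get, by rw [Fin.univ_val_map, List.ofFn_get]; rfl⟩
  have hle : ∀ I : Finset (Fin n), I.val.map a ≤ (Finset.univ : Finset (Fin n)).val.map a :=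
    fun I => Multiset.map_le_map (Finset.val_le_iff.mpr (Finset.subset_univ I))
  obtain ⟨T, _, hTc, hT0⟩ := Kem.main hp7 a Finset.univ (by simpa using hJ) (c : ZMod p) (by
    intro I _ hIc
    have := hc (I.val.map a) (hle I) (by simpa using hIc)
    rw [Kem.N_eq] at this
    have h2 := (ZMod.intCast_eq_intCast_iff _ _ _).mpr this
    simpa using h2)
  exact ⟨T.val.map a, hle T, by simpa using hTc, hT0⟩
end
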